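/- Let d ≥ 1, 0 < s < 1/2, and let f : [−1,1] → ℝ be C^{1,α} with α > 1−2s. Let u be a stable solution of (−Δ)^s u = f(u) in ℝ^d with |u| ≤ 1. Then there is a constant C₁ = C₁(d,s), independent of f, such that for every x₀ ∈ ℝ^d and every R ≥ 1: J^s(u, B_R(x₀)) ≤ C₁ · R^{d−2s}. -/

import Mathlib

open MeasureTheory Metric Set
open scoped ENNReal NNReal

/-- The fractional `s`-energy `J^s(u,Ω)` of `u : ℝ^d → ℝ` on an open set `Ω`:
`J^s(u,Ω) = ∬_{(ℝ^d×ℝ^d)∖(Ωᶜ×Ωᶜ)} |u(x)−u(y)|²/|x−y|^{d+2s} dy dx`, valued in `[0,∞]`. -/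
noncomputable def Js (d : ℕ) (s : ℝ) (u : EuclideanSpace ℝ (Fin d) → ℝ)
    (Ω : Set (EuclideanSpace ℝ (Fin d))) : ℝ≥0∞ :=
  ∫⁻ p : EuclideanSpace ℝ (Fin d) × EuclideanSpace ℝ (Fin d) in (Ωᶜ ×ˢ Ωᶜ)ᶜ,
    ENNReal.ofReal ((u p.1 - u p.2)^2 / ‖p.1 - p.2‖ ^ ((d : ℝ) + 2*s))

/-- The normalizing constant `C(d,s) = 2^{2s} Γ(d/2+s) / (π^{d/2} |Γ(−s)|)` of the fractional
Laplacian, which normalizes its Fourier symbol to `|ξ|^{2s}`. -/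
noncomputable def fracC (d : ℕ) (s : ℝ) : ℝ :=
  2 ^ (2*s) * Real.Gamma ((d : ℝ)/2 + s) / (Real.pi ^ ((d : ℝ)/2) * |Real.Gamma (-s)|)

/-- `f : [−1,1] → ℝ` is `C^{1,α}`: it has derivative `f'` on `[−1,1]` and `f'` is
`α`-Hölder continuous on `[−1,1]`. -/
def IsC1Alpha (f f' : ℝ → ℝ) (α : ℝ) : Prop :=
  (∀ x ∈ Set.Icc (-1 : ℝ) 1, HasDerivAt f (f' x) x) ∧
  ∃ Cα : ℝ, 0 ≤ Cα ∧ ∀ x ∈ Set.Icc (-1 : ℝ) 1, ∀ y ∈ Set.Icc (-1 : ℝ) 1,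
    |f' x - f' y| ≤ Cα * |x - y| ^ α

/-- `u ∈ C²(ℝ^d)` with `|u| ≤ 1` is a stable solution of `(−Δ)^s u = f(u)` in `ℝ^d`:
the equation `(C(d,s)/2)∫ (2u(x)−u(x+y)−u(x−y))/|y|^{d+2s} dy = f(u(x))` holds pointwise and
for every `η ∈ C_c^∞(ℝ^d)` one has
`(C(d,s)/2) ∬ |η(x)−η(y)|²/|x−y|^{d+2s} dx dy ≥ ∫ f'(u(x)) η(x)² dx`. -/
def IsStableSolution (d : ℕ) (s : ℝ) (f f' : ℝ → ℝ)
    (u : EuclideanSpace ℝ (Fin d) → ℝ) : Prop :=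
  ContDiff ℝ 2 u ∧ (∀ x, |u x| ≤ 1) ∧
  (∀ x : EuclideanSpace ℝ (Fin d),
    fracC d s / 2 * ∫ y : EuclideanSpace ℝ (Fin d),
      (2 * u x - u (x + y) - u (x - y)) / ‖y‖ ^ ((d : ℝ) + 2*s) = f (u x)) ∧
  (∀ η : EuclideanSpace ℝ (Fin d) → ℝ, ContDiff ℝ (⊤ : ℕ∞) η → HasCompactSupport η →
    ∫ x : EuclideanSpace ℝ (Fin d), f' (u x) * (η x)^2 ≤
      fracC d s / 2 * ∫ x : EuclideanSpace ℝ (Fin d), ∫ y : EuclideanSpace ℝ (Fin d),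
        (η x - η y)^2 / ‖x - y‖ ^ ((d : ℝ) + 2*s))


open Filter Topology

abbrev EE (d : ℕ) := EuclideanSpace ℝ (Fin d)

noncomputable def KK (d : ℕ) (s : ℝ) (z : EE d) : ℝ := (‖z‖ ^ ((d : ℝ) + 2*s))⁻¹

lemma KK_nonneg (d : ℕ) (s : ℝ) (z : EE d) : 0 ≤ KK d s z := by
  unfold KK; positivity

lemma KK_neg (d : ℕ) (s : ℝ) (z : EE d) : KK d s (-z) = KK d s z := by
  simp [KK]

lemma KK_comm (d : ℕ) (s : ℝ) (x y : EE d) : KK d s (x - y) = KK d s (y - x) := by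
  rw [← KK_neg, neg_sub]

lemma KK_meas (d : ℕ) (s : ℝ) : Measurable (KK d s) := by
  unfold KK; fun_prop

lemma KK_int (d : ℕ) (hd : 1 ≤ d) (s : ℝ) (hs0 : 0 < s) (hs1 : s < 1/2) :
    Integrable (fun z : EE d => min ‖z‖ 1 * KK d s z) := by
  haveI : Nonempty (Fin d) := ⟨⟨0, hd⟩⟩
  have key := integrable_fun_norm_addHaar (E := EE d) volume
    (f := fun r : ℝ => min r 1 * (r ^ ((d:ℝ) + 2*s))⁻¹)
  simp only [finrank_euclideanSpace, Fintype.card_fin] at key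
  refine key.2 ?_
  have h1 : ∀ r : ℝ, 0 < r → r ^ (d - 1) • (min r 1 * (r ^ ((d:ℝ) + 2*s))⁻¹)
      = min r 1 * r ^ (-1 - 2*s) := by
    intro r hr
    rw [smul_eq_mul, ← Real.rpow_natCast, ← Real.rpow_neg hr.le, mul_left_comm,
      ← Real.rpow_add hr]
    congr 2
    push_cast [Nat.cast_sub hd]; ring
  rw [← Ioc_union_Ioi_eq_Ioi (zero_le_one' ℝ)]
  refine IntegrableOn.union ?_ ?_
  · have h2 : IntegrableOn (fun r : ℝ => r ^ (-2*s)) (Ioc 0 1) := by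
      rw [← intervalIntegrable_iff_integrableOn_Ioc_of_le zero_le_one]
      exact intervalIntegral.intervalIntegrable_rpow' (by linarith)
    refine h2.congr_fun ?_ measurableSet_Ioc
    intro r hr
    simp only [] 
    rw [h1 r hr.1, min_eq_left hr.2, ← Real.rpow_one_add' hr.1.le (by linarith)]
    congr 1; ring
  · have h2 : IntegrableOn (fun r : ℝ => r ^ (-1-2*s)) (Ioi 1) :=
      integrableOn_Ioi_rpow_of_lt (by linarith) one_pos
    refine h2.congr_fun ?_ measurableSet_Ioi
    intro r hr
    have hr' : (1:ℝ) < r := hr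
    simp only []
    rw [h1 r (by linarith), min_eq_right hr'.le, one_mul]

lemma KK_scale (d : ℕ) (s r : ℝ) (hr : 0 < r) :
    ∫ z : EE d, min (‖z‖ / r) 1 * KK d s z
      = r ^ (-2*s) * ∫ z : EE d, min ‖z‖ 1 * KK d s z := by
  have h := Measure.integral_comp_smul (volume : Measure (EE d))
    (fun z => min (‖z‖ / r) 1 * KK d s z) r
  have h2 : ∀ z : EE d, min (‖r • z‖ / r) 1 * KK d s (r • z)
      = r ^ (-((d:ℝ) + 2*s)) * (min ‖z‖ 1 * KK d s z) := by
    intro z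
    unfold KK
    rw [norm_smul, Real.norm_of_nonneg hr.le, mul_div_cancel_left₀ _ hr.ne',
      Real.mul_rpow hr.le (norm_nonneg _), mul_inv, Real.rpow_neg hr.le]
    ring
  simp only [h2, finrank_euclideanSpace, Fintype.card_fin, smul_eq_mul] at h
  rw [integral_const_mul, abs_of_pos (by positivity)] at h
  have h3 : ∫ z : EE d, min (‖z‖ / r) 1 * KK d s z
    = r ^ d * (r ^ (-((d:ℝ) + 2*s)) * ∫ z : EE d, min ‖z‖ 1 * KK d s z) := by
    rw [h]; field_simp
  rw [h3, ← mul_assoc, ← Real.rpow_natCast, ← Real.rpow_add hr]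
  congr 2; ring

/-- shear -/
lemma shear_mp (d : ℕ) : MeasurePreserving (fun p : EE d × EE d => (p.1, p.2 - p.1))
    (volume) (volume) := by
  have := measurePreserving_prod_neg_add (volume : Measure (EE d)) (volume : Measure (EE d))
  convert! this using 2
  ext1
  · rfl
  · simp; abel

lemma base_int (d : ℕ) (hd : 1 ≤ d) (s : ℝ) (hs0 : 0 < s) (hs1 : s < 1/2)
    (B : Set (EE d)) (hB : MeasurableSet B) (hBf : volume B < ⊤) :
    Integrable (fun p : EE d × EE d =>
      B.indicator (fun _ => (1:ℝ)) p.1 * (min ‖p.1 - p.2‖ 1 * KK d s (p.1 - p.2))) := by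
  have h1 : Integrable (B.indicator (fun _ => (1:ℝ))) (volume : Measure (EE d)) :=
    (integrable_indicator_iff hB).2 (integrableOn_const hBf.ne)
  have h2 := h1.mul_prod (KK_int d hd s hs0 hs1)
  have h3 := (shear_mp d).integrable_comp_of_integrable h2
  refine h3.congr (Eventually.of_forall fun p => ?_)
  simp only [Function.comp, norm_sub_rev p.2 p.1, KK_comm d s p.2 p.1]

lemma swap_mp (d : ℕ) : MeasurePreserving (fun p : EE d × EE d => (p.2, p.1))
    (volume) (volume) := Measure.measurePreserving_swap

noncomputable def ind (d : ℕ) (r : ℝ) (x : EE d) : ℝ :=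
  (closedBall (0 : EE d) r).indicator (fun _ => (1:ℝ)) x

lemma ind_nonneg (d : ℕ) (r : ℝ) (x : EE d) : 0 ≤ ind d r x :=
  indicator_nonneg (fun _ _ => zero_le_one) _

lemma ind_eq_one {d : ℕ} {r : ℝ} {x : EE d} (h : ‖x‖ ≤ r) : ind d r x = 1 := by
  simp [ind, h]

lemma ind_eq_zero {d : ℕ} {r : ℝ} {x : EE d} (h : r < ‖x‖) : ind d r x = 0 := by
  simp [ind, h]

lemma prod_int (d : ℕ) (hd : 1 ≤ d) (s : ℝ) (hs0 : 0 < s) (hs1 : s < 1/2)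
    (r C : ℝ) (H : EE d × EE d → ℝ) (hH : Measurable H)
    (hb : ∀ x y, |H (x, y)| ≤ C * (min ‖x - y‖ 1 * (ind d r x + ind d r y))) :
    Integrable (fun p : EE d × EE d => H p * KK d s (p.1 - p.2)) := by
  have h1 := base_int d hd s hs0 hs1 (closedBall 0 r) measurableSet_closedBall
    measure_closedBall_lt_top
  have h2 := (swap_mp d).integrable_comp_of_integrable h1
  refine ((h1.add h2).const_mul C).mono' ?_ (Eventually.of_forall fun p => ?_)
  · exact (hH.mul ((KK_meas d s).comp (measurable_fst.sub measurable_snd))).aestronglyMeasurable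
  · rw [norm_mul, Real.norm_eq_abs, Real.norm_of_nonneg (KK_nonneg d s _)]
    refine (mul_le_mul_of_nonneg_right (hb p.1 p.2) (KK_nonneg d s _)).trans (le_of_eq ?_)
    simp only [Function.comp, ind, Pi.add_apply, norm_sub_rev p.2 p.1, KK_comm d s p.2 p.1]
    ring

/-- bounded locally Lipschitz functions -/
def LL {d : ℕ} (u : EE d → ℝ) : Prop :=
  Continuous u ∧ (∃ M, 0 ≤ M ∧ ∀ x, |u x| ≤ M) ∧
  ∀ r : ℝ, ∃ C : ℝ, 0 ≤ C ∧ ∀ x, ‖x‖ ≤ r → ∀ y, |u x - u y| ≤ C * min ‖x - y‖ 1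

lemma LL.mul {d : ℕ} {u v : EE d → ℝ} (hu : LL u) (hv : LL v) : LL (fun x => u x * v x) := by
  obtain ⟨hc, ⟨M, hM0, hM⟩, hl⟩ := hu
  obtain ⟨hc', ⟨M', hM0', hM'⟩, hl'⟩ := hv
  refine ⟨hc.mul hc', ⟨M * M', by positivity, fun x => ?_⟩, fun r => ?_⟩
  · rw [abs_mul]; exact mul_le_mul (hM x) (hM' x) (abs_nonneg _) hM0
  · obtain ⟨C, hC0, hC⟩ := hl r
    obtain ⟨C', hC0', hC'⟩ := hl' r
    refine ⟨M * C' + M' * C, by positivity, fun x hx y => ?_⟩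
    have e : u x * v x - u y * v y = u x * (v x - v y) + v y * (u x - u y) := by ring
    rw [e]
    refine (abs_add_le _ _).trans ?_
    rw [abs_mul, abs_mul, add_mul, mul_assoc, mul_assoc]
    exact add_le_add (mul_le_mul (hM x) (hC' x hx y) (abs_nonneg _) hM0)
      (mul_le_mul (hM' y) (hC x hx y) (abs_nonneg _) hM0')

lemma LL.abs {d : ℕ} {u : EE d → ℝ} (hu : LL u) : LL (fun x => |u x|) := by
  obtain ⟨hc, ⟨M, hM0, hM⟩, hl⟩ := hu
  refine ⟨hc.abs, ⟨M, hM0, fun x => by rw [abs_abs]; exact hM x⟩, fun r => ?_⟩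
  obtain ⟨C, hC0, hC⟩ := hl r
  exact ⟨C, hC0, fun x hx y => (abs_abs_sub_abs_le _ _).trans (hC x hx y)⟩

lemma LL.sub {d : ℕ} {u v : EE d → ℝ} (hu : LL u) (hv : LL v) : LL (fun x => u x - v x) := by
  obtain ⟨hc, ⟨M, hM0, hM⟩, hl⟩ := hu
  obtain ⟨hc', ⟨M', hM0', hM'⟩, hl'⟩ := hv
  refine ⟨hc.sub hc', ⟨M + M', by positivity, fun x => ?_⟩, fun r => ?_⟩
  · exact (abs_sub _ _).trans (add_le_add (hM x) (hM' x))
  · obtain ⟨C, hC0, hC⟩ := hl r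
    obtain ⟨C', hC0', hC'⟩ := hl' r
    refine ⟨C + C', by positivity, fun x hx y => ?_⟩
    have e : u x - v x - (u y - v y) = (u x - u y) - (v x - v y) := by ring
    rw [e, add_mul]
    exact (abs_sub _ _).trans (add_le_add (hC x hx y) (hC' x hx y))

lemma LL.const {d : ℕ} (c : ℝ) : LL (fun _ : EE d => c) :=
  ⟨continuous_const, ⟨|c|, abs_nonneg _, fun _ => le_rfl⟩, fun _ => ⟨0, le_rfl, fun x _ y => by simp⟩⟩

lemma LL.shift {d : ℕ} {u : EE d → ℝ} (hu : LL u) (a : EE d) : LL (fun x => u (x + a)) := by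
  obtain ⟨hc, ⟨M, hM0, hM⟩, hl⟩ := hu
  refine ⟨hc.comp (continuous_add_const a), ⟨M, hM0, fun x => hM _⟩, fun r => ?_⟩
  obtain ⟨C, hC0, hC⟩ := hl (r + ‖a‖)
  refine ⟨C, hC0, fun x hx y => ?_⟩
  have := hC (x + a) ((norm_add_le _ _).trans (by linarith)) (y + a)
  simpa using this

lemma LL.of_contDiff {d : ℕ} {u : EE d → ℝ} (hu : ContDiff ℝ 1 u) (M : ℝ) (hM0 : 0 ≤ M)
    (hM : ∀ x, |u x| ≤ M) : LL u := by
  refine ⟨hu.continuous, ⟨M, hM0, hM⟩, fun r => ?_⟩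
  have hcont : Continuous (fun x => ‖fderiv ℝ u x‖) := (hu.continuous_fderiv (by simp)).norm
  obtain ⟨C, hC⟩ := (isCompact_closedBall (0 : EE d) (r+1)).exists_bound_of_continuousOn
    hcont.continuousOn
  refine ⟨max C (2*M), le_max_of_le_right (by positivity), fun x hx y => ?_⟩
  by_cases hxy : ‖x - y‖ ≤ 1
  · rw [min_eq_left hxy]
    have hy : ‖y‖ ≤ r + 1 := by
      have : ‖y‖ ≤ ‖x‖ + ‖x - y‖ := by
        have := norm_sub_norm_le y x
        rw [norm_sub_rev] at this; linarith
      linarith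
    have := (convex_closedBall (0 : EE d) (r+1)).norm_image_sub_le_of_norm_fderiv_le
      (f := u) (C := C) (𝕜 := ℝ) (fun z _ => (hu.differentiable (by simp)) z)
      (fun z hz => by simpa using hC z hz) (x := y) (y := x) (by simpa using hy)
      (by simp; linarith)
    rw [Real.norm_eq_abs] at this
    exact this.trans (mul_le_mul_of_nonneg_right (le_max_left _ _) (norm_nonneg _))
  · rw [min_eq_right (by linarith), mul_one]
    refine le_max_of_le_right ((abs_sub _ _).trans ?_)
    linarith [hM x, hM y]

/-- compactly supported nice function -/
lemma LL.global {d : ℕ} {u : EE d → ℝ} (hu : LL u) {r : ℝ} (hr : ∀ x, r < ‖x‖ → u x = 0) :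
    ∃ C, 0 ≤ C ∧ ∀ x y, |u x - u y| ≤ C * (min ‖x - y‖ 1 * (ind d r x + ind d r y)) := by
  obtain ⟨C, hC0, hC⟩ := hu.2.2 r
  refine ⟨C, hC0, fun x y => ?_⟩
  have hm : 0 ≤ min ‖x - y‖ 1 := le_min (norm_nonneg _) zero_le_one
  by_cases hx : ‖x‖ ≤ r
  · refine (hC x hx y).trans (mul_le_mul_of_nonneg_left ?_ hC0)
    rw [ind_eq_one hx]
    nlinarith [ind_nonneg d r y]
  · by_cases hy : ‖y‖ ≤ r
    · rw [abs_sub_comm]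
      refine (hC y hy x).trans (mul_le_mul_of_nonneg_left ?_ hC0)
      rw [ind_eq_one hy, norm_sub_rev]
      nlinarith [ind_nonneg d r x]
    · rw [hr x (by linarith), hr y (by linarith), sub_zero, abs_zero]
      have := ind_nonneg d r x
      have := ind_nonneg d r y
      positivity

lemma LL.sec_int {d : ℕ} (hd : 1 ≤ d) {s : ℝ} (hs0 : 0 < s) (hs1 : s < 1/2)
    {u : EE d → ℝ} (hu : LL u) (x : EE d) :
    Integrable (fun z => (u x - u (x + z)) * KK d s z) := by
  obtain ⟨C, hC0, hC⟩ := hu.2.2 ‖x‖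
  refine ((KK_int d hd s hs0 hs1).const_mul C).mono' ?_ (Eventually.of_forall fun z => ?_)
  · have := hu.1
    exact ((by fun_prop : Continuous (fun z => u x - u (x + z))).measurable.mul
      (KK_meas d s)).aestronglyMeasurable
  · rw [norm_mul, Real.norm_eq_abs, Real.norm_of_nonneg (KK_nonneg d s _), ← mul_assoc]
    refine mul_le_mul_of_nonneg_right ?_ (KK_nonneg d s _)
    simpa using hC x le_rfl (x + z)

lemma weak_eq {d : ℕ} (hd : 1 ≤ d) {s : ℝ} (hs0 : 0 < s) (hs1 : s < 1/2)
    {u ψ : EE d → ℝ} (hu : LL u) (hψ : LL ψ) {r : ℝ} (hr : ∀ x, r < ‖x‖ → ψ x = 0) :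
    ∫ x, ψ x * (∫ y, (2 * u x - u (x + y) - u (x - y)) / ‖y‖ ^ ((d : ℝ) + 2*s))
    = ∫ p : EE d × EE d, ((u p.1 - u p.2) * (ψ p.1 - ψ p.2)) * KK d s (p.1 - p.2) := by
  have hin : ∀ x, (∫ y, (2 * u x - u (x + y) - u (x - y)) / ‖y‖ ^ ((d : ℝ) + 2*s))
      = 2 * ∫ y, (u x - u y) * KK d s (x - y) := by
    intro x
    have h1 := hu.sec_int hd hs0 hs1 x
    have h2 := h1.comp_neg
    simp only [← sub_eq_add_neg, KK_neg] at h2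
    have e1 : ∫ z, (u x - u (x + z)) * KK d s z = ∫ y, (u x - u y) * KK d s (x - y) := by
      rw [← integral_add_left_eq_self (fun y => (u x - u y) * KK d s (x - y)) x]
      congr 1; ext z; rw [← KK_neg]; simp
    have e2 : ∫ z, (u x - u (x - z)) * KK d s z = ∫ y, (u x - u y) * KK d s (x - y) := by
      rw [← integral_sub_left_eq_self (fun y => (u x - u y) * KK d s (x - y)) volume x]
      congr 1; ext z; simp
    have : ∀ y, (2 * u x - u (x + y) - u (x - y)) / ‖y‖ ^ ((d : ℝ) + 2*s)
        = (u x - u (x + y)) * KK d s y + (u x - u (x - y)) * KK d s y := by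
      intro y; unfold KK; ring
    simp only [this]
    rw [integral_add h1 h2, e1, e2]; ring
  simp only [hin]
  obtain ⟨C, hC0, hC⟩ := hu.2.2 r
  obtain ⟨M, hM0, hM⟩ := hψ.2.1
  have huc := hu.1
  have hψc := hψ.1
  have hI1 : Integrable (fun p : EE d × EE d =>
      (ψ p.1 * (u p.1 - u p.2)) * KK d s (p.1 - p.2)) := by
    refine prod_int d hd s hs0 hs1 r (M * C) (fun p => ψ p.1 * (u p.1 - u p.2))
      (by fun_prop) fun x y => ?_
    simp only [abs_mul]
    have hm : 0 ≤ min ‖x - y‖ 1 := le_min (norm_nonneg _) zero_le_one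
    by_cases hx : ‖x‖ ≤ r
    · rw [mul_assoc]
      refine mul_le_mul (hM x) ((hC x hx y).trans ?_) (abs_nonneg _) hM0
      refine mul_le_mul_of_nonneg_left ?_ hC0
      rw [ind_eq_one hx]
      nlinarith [ind_nonneg d r y]
    · rw [hr x (by linarith), abs_zero, zero_mul]
      have := ind_nonneg d r x
      have := ind_nonneg d r y
      positivity
  have hI2 : Integrable (fun p : EE d × EE d =>
      (ψ p.2 * (u p.2 - u p.1)) * KK d s (p.2 - p.1)) :=
    (swap_mp d).integrable_comp_of_integrable hI1
  have e2 : ∫ p : EE d × EE d, (ψ p.2 * (u p.2 - u p.1)) * KK d s (p.2 - p.1)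
      = ∫ p : EE d × EE d, (ψ p.1 * (u p.1 - u p.2)) * KK d s (p.1 - p.2) :=
    (swap_mp d).integral_comp (MeasurableEquiv.prodComm.measurableEmbedding)
      (fun p : EE d × EE d => (ψ p.1 * (u p.1 - u p.2)) * KK d s (p.1 - p.2))
  have e1 : ∫ x, ψ x * (2 * ∫ y, (u x - u y) * KK d s (x - y))
      = 2 * ∫ p : EE d × EE d, (ψ p.1 * (u p.1 - u p.2)) * KK d s (p.1 - p.2) := by
    rw [Measure.volume_eq_prod, integral_prod _ hI1, ← integral_const_mul]
    congr 1; ext x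
    simp only [mul_assoc]
    rw [integral_const_mul]; ring
  rw [e1, two_mul]
  nth_rewrite 2 [← e2]
  rw [← integral_add hI1 hI2]
  congr 1; ext p
  rw [KK_comm d s p.2 p.1]; ring

lemma stab_ext {d : ℕ} (hd : 1 ≤ d) {s : ℝ} (hs0 : 0 < s) (hs1 : s < 1/2) (c : ℝ)
    {g : EE d → ℝ} (hg : Continuous g)
    (hst : ∀ η : EE d → ℝ, ContDiff ℝ (⊤ : ℕ∞) η → HasCompactSupport η →
      ∫ x, g x * (η x)^2 ≤ c * ∫ x : EE d, ∫ y : EE d,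
        (η x - η y)^2 / ‖x - y‖ ^ ((d : ℝ) + 2*s))
    {η : EE d → ℝ} (hη : LL η) {r : ℝ} (hr : ∀ x, r < ‖x‖ → η x = 0) :
    ∫ x, g x * (η x)^2 ≤ c * ∫ p : EE d × EE d, (η p.1 - η p.2)^2 * KK d s (p.1 - p.2) := by
  obtain ⟨C, hC0, hC⟩ := hη.global hr
  obtain ⟨M, hM0, hM⟩ := hη.2.1
  have hηc := hη.1
  let b : ℕ → ContDiffBump (0 : EE d) := fun n =>
    ⟨1 / (2 * ((n:ℝ) + 1)), 1 / ((n:ℝ)+1), by positivity, by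
      apply one_div_lt_one_div_of_lt <;> linarith [(Nat.cast_nonneg n : (0:ℝ) ≤ n)]⟩
  have hb : ∀ n, (b n).rOut = 1 / ((n:ℝ)+1) := fun n => rfl
  have hb1 : ∀ n, (b n).rOut ≤ 1 := fun n => by
    rw [hb, div_le_one (by positivity)]; linarith [(Nat.cast_nonneg n : (0:ℝ) ≤ n)]
  let k : ℕ → EE d → ℝ := fun n => (b n).normed volume
  let η' : ℕ → EE d → ℝ := fun n x => ∫ t, k n t * η (x - t)
  have hη' : ∀ n, η' n = convolution (k n) η (ContinuousLinearMap.lsmul ℝ ℝ) volume := by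
    intro n; ext x; rfl
  have hk0 : ∀ n t, 0 ≤ k n t := fun n t => (b n).nonneg_normed t
  have hkI : ∀ n, Integrable (k n) := fun n => (b n).integrable_normed
  have hk1 : ∀ n, ∫ t, k n t = 1 := fun n => (b n).integral_normed
  have hks : ∀ n t, 1 ≤ ‖t‖ → k n t = 0 := by
    intro n t ht
    by_contra h
    have : t ∈ Function.support (k n) := h
    rw [(b n).support_normed_eq] at this
    simp at this
    linarith [hb1 n]
  have hkint : ∀ n x, Integrable (fun t => k n t * η (x - t)) := by
    intro n x
    refine ((hkI n).mul_const M).mono' ?_ (Eventually.of_forall fun t => ?_)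
    · exact ((b n).continuous_normed.mul (hηc.comp (by fun_prop))).aestronglyMeasurable
    · rw [norm_mul, Real.norm_of_nonneg (hk0 n t), Real.norm_eq_abs]
      exact mul_le_mul_of_nonneg_left (hM _) (hk0 n t)
  have hM' : ∀ n x, |η' n x| ≤ M := by
    intro n x
    have : ‖η' n x‖ ≤ ∫ t, k n t * M := by
      refine norm_integral_le_of_norm_le ((hkI n).mul_const M) (Eventually.of_forall fun t => ?_)
      rw [norm_mul, Real.norm_of_nonneg (hk0 n t), Real.norm_eq_abs]
      exact mul_le_mul_of_nonneg_left (hM _) (hk0 n t)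
    rwa [integral_mul_const, hk1, one_mul] at this
  have hr' : ∀ n x, r + 1 < ‖x‖ → η' n x = 0 := by
    intro n x hx
    have : ∀ t, k n t * η (x - t) = 0 := by
      intro t
      by_cases ht : 1 ≤ ‖t‖
      · rw [hks n t ht, zero_mul]
      · rw [hr (x - t), mul_zero]
        have := norm_sub_norm_le x t
        linarith
    simp [η', this]
  have hlip : ∀ n x y, |η' n x - η' n y| ≤ (2 * C) * min ‖x - y‖ 1 := by
    intro n x y
    have e : η' n x - η' n y = ∫ t, k n t * (η (x - t) - η (y - t)) := by
      simp only [η', mul_sub]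
      rw [integral_sub (hkint n x) (hkint n y)]
    have : ‖η' n x - η' n y‖ ≤ ∫ t, k n t * ((2 * C) * min ‖x - y‖ 1) := by
      rw [e]
      refine norm_integral_le_of_norm_le ((hkI n).mul_const _) (Eventually.of_forall fun t => ?_)
      rw [norm_mul, Real.norm_of_nonneg (hk0 n t), Real.norm_eq_abs]
      refine mul_le_mul_of_nonneg_left ?_ (hk0 n t)
      refine (hC _ _).trans ?_
      have h1 : ∀ z, ind d r z ≤ 1 := fun z => by
        by_cases hz : ‖z‖ ≤ r
        · rw [ind_eq_one hz]
        · rw [ind_eq_zero (by linarith)]; exact zero_le_one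
      have hm : 0 ≤ min ‖x - y‖ 1 := le_min (norm_nonneg _) zero_le_one
      have e2 : x - t - (y - t) = x - y := by abel
      rw [e2]
      have := mul_le_mul_of_nonneg_left (add_le_add (h1 (x-t)) (h1 (y-t))) (mul_nonneg hC0 hm)
      nlinarith
    rwa [integral_mul_const, hk1, one_mul] at this
  have hlip' : ∀ n x y, |(η' n x - η' n y)^2| ≤
      (4 * C^2) * (min ‖x - y‖ 1 * (ind d (r+1) x + ind d (r+1) y)) := by
    intro n x y
    have hm : 0 ≤ min ‖x - y‖ 1 := le_min (norm_nonneg _) zero_le_one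
    have hm1 : min ‖x - y‖ 1 ≤ 1 := min_le_right _ _
    have i1 := ind_nonneg d (r+1) x
    have i2 := ind_nonneg d (r+1) y
    by_cases hxy : ‖x‖ ≤ r + 1 ∨ ‖y‖ ≤ r + 1
    · have hi : 1 ≤ ind d (r+1) x + ind d (r+1) y := by
        rcases hxy with h | h
        · rw [ind_eq_one h]; linarith
        · rw [ind_eq_one h]; linarith
      rw [abs_pow]
      have h1 : |η' n x - η' n y|^2 ≤ ((2 * C) * min ‖x - y‖ 1)^2 :=
        pow_le_pow_left₀ (abs_nonneg _) (hlip n x y) 2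
      have h2 : (min ‖x - y‖ 1)^2 ≤ min ‖x - y‖ 1 * (ind d (r+1) x + ind d (r+1) y) := by
        rw [pow_two]; exact mul_le_mul_of_nonneg_left (hm1.trans hi) hm
      calc _ ≤ _ := h1
        _ = (4 * C^2) * (min ‖x - y‖ 1)^2 := by ring
        _ ≤ _ := mul_le_mul_of_nonneg_left h2 (by positivity)
    · push Not at hxy
      rw [hr' n x hxy.1, hr' n y hxy.2]
      simp; positivity
  have hsm : ∀ n, ContDiff ℝ (⊤ : ℕ∞) (η' n) := by
    intro n
    rw [hη' n]
    exact (b n).hasCompactSupport_normed.contDiff_convolution_left _ (b n).contDiff_normed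
      hηc.locallyIntegrable
  have hcs : ∀ n, HasCompactSupport (η' n) := by
    intro n
    refine HasCompactSupport.intro (isCompact_closedBall (0 : EE d) (r+1)) fun x hx => hr' n x ?_
    simpa using hx
  have hlim : ∀ x, Tendsto (fun n => η' n x) atTop (𝓝 (η x)) := by
    intro x
    simp only [hη']
    exact ContDiffBump.convolution_tendsto_right_of_continuous
      (by simp only [hb]; exact tendsto_one_div_add_atTop_nhds_zero_nat) hηc x
  have hdom := base_int d hd s hs0 hs1 (closedBall 0 (r+1)) measurableSet_closedBall
    measure_closedBall_lt_top
  have hdom2 := ((hdom.add ((swap_mp d).integrable_comp_of_integrable hdom)).const_mul (4*C^2))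
  have hint : ∀ n, Integrable (fun p : EE d × EE d =>
      (η' n p.1 - η' n p.2)^2 * KK d s (p.1 - p.2)) := by
    intro n
    have := (hsm n).continuous
    exact prod_int d hd s hs0 hs1 (r+1) (4*C^2) (fun p => (η' n p.1 - η' n p.2)^2)
      (by fun_prop) (hlip' n)
  have hineq : ∀ n, ∫ x, g x * (η' n x)^2 ≤
      c * ∫ p : EE d × EE d, (η' n p.1 - η' n p.2)^2 * KK d s (p.1 - p.2) := by
    intro n
    have := hst (η' n) (hsm n) (hcs n)
    rw [Measure.volume_eq_prod, integral_prod _ (hint n)]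
    exact this
  refine le_of_tendsto_of_tendsto' (b := atTop) ?_ ?_ hineq
  · have hbi : Integrable (fun x => |g x| * M^2 * ind d (r+1) x) := by
      have : IntegrableOn (fun x => |g x| * M^2) (closedBall (0 : EE d) (r+1)) :=
        (hg.abs.mul continuous_const).continuousOn.integrableOn_compact (isCompact_closedBall _ _)
      refine (this.integrable_indicator measurableSet_closedBall).congr
        (Eventually.of_forall fun x => ?_)
      by_cases hx : ‖x‖ ≤ r+1
      · simp [ind_eq_one hx, hx]
      · simp [ind_eq_zero (not_le.1 hx), hx]
    refine tendsto_integral_of_dominated_convergence _ (fun n => ?_) hbi (fun n => ?_) ?_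
    · exact (hg.mul ((hsm n).continuous.pow 2)).aestronglyMeasurable
    · refine Eventually.of_forall fun x => ?_
      rw [norm_mul, Real.norm_eq_abs, norm_pow, Real.norm_eq_abs, mul_assoc]
      refine mul_le_mul_of_nonneg_left ?_ (abs_nonneg _)
      by_cases hx : ‖x‖ ≤ r+1
      · rw [ind_eq_one hx, mul_one]
        exact pow_le_pow_left₀ (abs_nonneg _) (hM' n x) 2
      · rw [hr' n x (not_le.1 hx), ind_eq_zero (not_le.1 hx)]; simp
    · exact Eventually.of_forall fun x => ((hlim x).pow 2).const_mul _
  · refine Tendsto.const_mul c ?_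
    refine tendsto_integral_of_dominated_convergence _ (fun n => (hint n).1) hdom2 (fun n => ?_) ?_
    · refine Eventually.of_forall fun p => ?_
      rw [norm_mul, Real.norm_eq_abs, Real.norm_of_nonneg (KK_nonneg d s _)]
      refine (mul_le_mul_of_nonneg_right (hlip' n p.1 p.2) (KK_nonneg d s _)).trans (le_of_eq ?_)
      simp only [Function.comp, ind, Pi.add_apply, norm_sub_rev p.2 p.1, KK_comm d s p.2 p.1]
      ring
    · exact Eventually.of_forall fun p => (((hlim p.1).sub (hlim p.2)).pow 2).mul_const _

lemma bil_int {d : ℕ} (hd : 1 ≤ d) {s : ℝ} (hs0 : 0 < s) (hs1 : s < 1/2)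
    {u ψ : EE d → ℝ} (hu : LL u) (hψ : LL ψ) {r : ℝ} (hr : ∀ x, r < ‖x‖ → ψ x = 0) :
    Integrable (fun p : EE d × EE d =>
      ((u p.1 - u p.2) * (ψ p.1 - ψ p.2)) * KK d s (p.1 - p.2)) := by
  obtain ⟨C, hC0, hC⟩ := hψ.global hr
  obtain ⟨M, hM0, hM⟩ := hu.2.1
  have huc := hu.1
  have hψc := hψ.1
  refine prod_int d hd s hs0 hs1 r (2 * M * C) (fun p => (u p.1 - u p.2) * (ψ p.1 - ψ p.2))
    (by fun_prop) fun x y => ?_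
  simp only [abs_mul]
  rw [mul_assoc]
  refine mul_le_mul ((abs_sub _ _).trans (by linarith [hM x, hM y])) (hC x y)
    (abs_nonneg _) (by positivity)

lemma G_int {d : ℕ} (hd : 1 ≤ d) {s : ℝ} (hs0 : 0 < s) (hs1 : s < 1/2)
    {φ : EE d → ℝ} (hφ : LL φ) {r : ℝ} (hr : ∀ x, r < ‖x‖ → φ x = 0) :
    Integrable (fun p : EE d × EE d => (φ p.1 - φ p.2)^2 * KK d s (p.1 - p.2)) := by
  simpa only [← pow_two] using bil_int hd hs0 hs1 hφ hφ hr

lemma main_h {d : ℕ} (hd : 1 ≤ d) {s : ℝ} (hs0 : 0 < s) (hs1 : s < 1/2) {c : ℝ} (hc : 0 < c)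
    {u F0 g : EE d → ℝ} (hu : LL u) (hF : Continuous F0) (hg : Continuous g)
    (heq : ∀ x, c / 2 * (∫ y, (2 * u x - u (x + y) - u (x - y)) / ‖y‖ ^ ((d : ℝ) + 2*s)) = F0 x)
    (hst : ∀ η : EE d → ℝ, ContDiff ℝ (⊤ : ℕ∞) η → HasCompactSupport η →
      ∫ x, g x * (η x)^2 ≤ c / 2 * ∫ x : EE d, ∫ y : EE d,
        (η x - η y)^2 / ‖x - y‖ ^ ((d : ℝ) + 2*s))
    {φ : EE d → ℝ} (hφ : LL φ) {r : ℝ} (hr : ∀ x, r < ‖x‖ → φ x = 0) (a : EE d)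
    {w : EE d → ℝ} (hw : ∀ x, w x = u (x + a) - u x) :
    Integrable (fun p : EE d × EE d =>
      (φ p.1 * φ p.2 * (|w p.1 * w p.2| - w p.1 * w p.2)) * KK d s (p.1 - p.2)) ∧
    2 * ∫ p : EE d × EE d,
      (φ p.1 * φ p.2 * (|w p.1 * w p.2| - w p.1 * w p.2)) * KK d s (p.1 - p.2)
    ≤ (∫ p : EE d × EE d, (w p.1 * w p.2) * ((φ p.1 - φ p.2)^2 * KK d s (p.1 - p.2)))
      + 2 / c * ∫ x, ((F0 (x + a) - F0 x) * w x - g x * w x ^ 2) * φ x ^ 2 := by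
  have hwe : w = fun x => u (x + a) - u x := funext hw
  have hua : LL (fun x => u (x + a)) := hu.shift a
  have hwL : LL w := by rw [hwe]; exact hua.sub hu
  set ψ : EE d → ℝ := fun x => φ x * (φ x * w x) with hψdef
  have hψ : LL ψ := hφ.mul (hφ.mul hwL)
  have hψr : ∀ x, r < ‖x‖ → ψ x = 0 := fun x hx => by simp [hψdef, hr x hx]
  set η : EE d → ℝ := fun x => φ x * |w x| with hηdef
  have hη : LL η := hφ.mul hwL.abs
  have hηr : ∀ x, r < ‖x‖ → η x = 0 := fun x hx => by simp [hηdef, hr x hx]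
  have hψcs : HasCompactSupport ψ :=
    HasCompactSupport.intro (isCompact_closedBall (0 : EE d) r) fun x hx => hψr x (by simpa using hx)
  have hηcs : HasCompactSupport η :=
    HasCompactSupport.intro (isCompact_closedBall (0 : EE d) r) fun x hx => hηr x (by simpa using hx)
  have hFa : Continuous (fun x => F0 (x + a)) := hF.comp (by fun_prop)
  have i1 : Integrable (fun x => ψ x * F0 x) :=
    (hψ.1.mul hF).integrable_of_hasCompactSupport hψcs.mul_right
  have i2 : Integrable (fun x => ψ x * F0 (x + a)) :=
    (hψ.1.mul hFa).integrable_of_hasCompactSupport hψcs.mul_right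
  have i3 : Integrable (fun x => g x * η x ^ 2) := by
    refine (hg.mul (hη.1.pow 2)).integrable_of_hasCompactSupport ?_
    refine HasCompactSupport.intro (isCompact_closedBall (0 : EE d) r) fun x hx => ?_
    simp [hηr x (by simpa using hx)]
  -- weak equations
  have w1 : ∫ x, ψ x * F0 x = c / 2 * ∫ p : EE d × EE d,
      ((u p.1 - u p.2) * (ψ p.1 - ψ p.2)) * KK d s (p.1 - p.2) := by
    rw [← weak_eq hd hs0 hs1 hu hψ hψr, ← integral_const_mul]
    congr 1; ext x; rw [← heq x]; ring
  have w2 : ∫ x, ψ x * F0 (x + a) = c / 2 * ∫ p : EE d × EE d,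
      ((u (p.1 + a) - u (p.2 + a)) * (ψ p.1 - ψ p.2)) * KK d s (p.1 - p.2) := by
    have := weak_eq hd hs0 hs1 hua hψ hψr
    rw [← this, ← integral_const_mul]
    congr 1; ext x; rw [← heq (x + a)]
    have e : ∀ y, x + y + a = x + a + y := fun y => by abel
    have e' : ∀ y, x - y + a = x + a - y := fun y => by abel
    simp only [e, e']; ring
  have w3 : ∫ x, ψ x * (F0 (x + a) - F0 x) = c / 2 * ∫ p : EE d × EE d,
      ((w p.1 - w p.2) * (ψ p.1 - ψ p.2)) * KK d s (p.1 - p.2) := by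
    simp only [mul_sub (ψ _)]
    rw [integral_sub i2 i1, w1, w2, ← mul_sub, ← integral_sub
      (bil_int hd hs0 hs1 hua hψ hψr) (bil_int hd hs0 hs1 hu hψ hψr)]
    congr 2; ext p; simp only [hw]; ring
  have st := stab_ext hd hs0 hs1 (c/2) hg hst hη hηr
  have j1 := bil_int hd hs0 hs1 hwL hψ hψr
  have j2 := G_int hd hs0 hs1 hη hηr
  obtain ⟨M, hM0, hM⟩ := hwL.2.1
  have j3 : Integrable (fun p : EE d × EE d =>
      (w p.1 * w p.2) * ((φ p.1 - φ p.2)^2 * KK d s (p.1 - p.2))) := by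
    have hwc := hwL.1
    refine (G_int hd hs0 hs1 hφ hr).bdd_mul (c := M * M)
      (f := fun p : EE d × EE d => w p.1 * w p.2)
      (by fun_prop : Continuous (fun p : EE d × EE d => w p.1 * w p.2)).aestronglyMeasurable ?_
    refine Eventually.of_forall fun p => ?_
    rw [norm_mul]
    exact mul_le_mul (hM _) (hM _) (norm_nonneg _) hM0
  have id : ∀ p : EE d × EE d,
      2 * ((φ p.1 * φ p.2 * (|w p.1 * w p.2| - w p.1 * w p.2)) * KK d s (p.1 - p.2))
      = ((w p.1 - w p.2) * (ψ p.1 - ψ p.2)) * KK d s (p.1 - p.2)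
        - (η p.1 - η p.2)^2 * KK d s (p.1 - p.2)
        + (w p.1 * w p.2) * ((φ p.1 - φ p.2)^2 * KK d s (p.1 - p.2)) := by
    intro p
    simp only [hψdef, hηdef, abs_mul]
    have h1 := abs_mul_abs_self (w p.1)
    have h2 := abs_mul_abs_self (w p.2)
    linear_combination (KK d s (p.1 - p.2) * φ p.1 ^ 2) * h1 + (KK d s (p.1 - p.2) * φ p.2 ^ 2) * h2
  have j4 := (j1.sub j2).add j3
  constructor
  · refine (j4.const_mul (1/2)).congr (Eventually.of_forall fun p => ?_)
    simp only [Pi.add_apply, Pi.sub_apply]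
    rw [← id p]; ring
  · rw [← integral_const_mul]
    simp only [id]
    have j12 : Integrable (fun p : EE d × EE d =>
        ((w p.1 - w p.2) * (ψ p.1 - ψ p.2)) * KK d s (p.1 - p.2)
        - (η p.1 - η p.2)^2 * KK d s (p.1 - p.2)) := j1.sub j2
    rw [integral_add j12 j3, integral_sub j1 j2]
    have e : ∫ x, ((F0 (x + a) - F0 x) * w x - g x * w x ^ 2) * φ x ^ 2
        = (∫ x, ψ x * (F0 (x + a) - F0 x)) - ∫ x, g x * η x ^ 2 := by
      have i4 : Integrable (fun x => ψ x * (F0 (x + a) - F0 x)) := by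
        simp only [mul_sub]
        exact i2.sub i1
      rw [← integral_sub i4 i3]
      congr 1; ext x
      simp only [hψdef, hηdef]
      have h1 := abs_mul_abs_self (w x)
      linear_combination (g x * φ x^2) * h1
    rw [e, w3]
    have : (2 / c) * (c/2) = 1 := by field_simp
    have h5 := mul_le_mul_of_nonneg_left st (by positivity : 0 ≤ 2 / c)
    rw [← mul_assoc, this, one_mul] at h5
    rw [mul_sub, ← mul_assoc, this, one_mul]
    linarith

lemma mixed1D {p q p' q' k k' k'' n : ℝ → ℝ} {h L A A' A'' : ℝ} (hh : 0 ≤ h) (hL : 0 ≤ L)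
    (hp : ∀ a, HasDerivAt p (p' a) a) (hq : ∀ a, HasDerivAt q (q' a) a)
    (hk : ∀ t, |t| ≤ h → HasDerivAt k (k' t) t) (hk' : ∀ t, |t| ≤ h → HasDerivAt k' (k'' t) t)
    (bp : ∀ a, |p' a| ≤ L) (bq : ∀ a, |q' a| ≤ L) (hn : ∀ t, 0 ≤ n t)
    (bpq : ∀ a b, |p a - q b| ≤ L * n (b - a))
    (bk : ∀ t, |t| ≤ h → |k t| ≤ A) (bk' : ∀ t, |t| ≤ h → |k' t| * n t ≤ A')
    (bk'' : ∀ t, |t| ≤ h → |k'' t| * n t ^ 2 ≤ A'') :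
    |(p h - q h)^2 * k (h - h) - (p h - q 0)^2 * k (0 - h) - (p 0 - q h)^2 * k (h - 0)
      + (p 0 - q 0)^2 * k (0 - 0)| ≤ h^2 * ((2 * A + 4 * A' + A'') * L^2) := by
  set D := (2 * A + 4 * A' + A'') * L^2 with hD
  have habs : ∀ a ∈ Icc 0 h, ∀ b ∈ Icc 0 h, |b - a| ≤ h := by
    intro a ha b hb
    rw [abs_le]; constructor <;> linarith [ha.1, ha.2, hb.1, hb.2]
  let ma : ℝ → ℝ → ℝ := fun a b => 2 * (p a - q b) * p' a * k (b - a) - (p a - q b)^2 * k' (b - a)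
  let mab : ℝ → ℝ → ℝ := fun a b => (2 * (- q' b) * p' a * k (b - a)
    + 2 * (p a - q b) * p' a * k' (b - a))
    - (2 * (p a - q b) * (- q' b) * k' (b - a) + (p a - q b)^2 * k'' (b - a))
  have hma : ∀ a ∈ Icc 0 h, ∀ b ∈ Icc 0 h,
      HasDerivAt (fun a => (p a - q b)^2 * k (b - a)) (ma a b) a := by
    intro a ha b hb
    have h1 := (hp a).sub_const (q b)
    have h2 := h1.pow 2
    have h3 : HasDerivAt (fun a => k (b - a)) (k' (b - a) * (-1)) a :=
      HasDerivAt.comp a (hk _ (habs a ha b hb)) ((hasDerivAt_id a).const_sub b)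
    refine (h2.mul h3).congr_deriv ?_
    simp only [ma]; simp; ring
  have hmab : ∀ a ∈ Icc 0 h, ∀ b ∈ Icc 0 h, HasDerivAt (fun b => ma a b) (mab a b) b := by
    intro a ha b hb
    have h1 : HasDerivAt (fun b => p a - q b) (- q' b) b := (hq b).const_sub (p a)
    have h2 := h1.pow 2
    have h0 : HasDerivAt (fun b : ℝ => b - a) 1 b := (hasDerivAt_id b).sub_const a
    have h3 : HasDerivAt (fun b => k (b - a)) (k' (b - a) * 1) b :=
      HasDerivAt.comp b (hk _ (habs a ha b hb)) h0
    have h4 : HasDerivAt (fun b => k' (b - a)) (k'' (b - a) * 1) b :=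
      HasDerivAt.comp b (hk' _ (habs a ha b hb)) h0
    refine ((((h1.const_mul 2).mul_const (p' a)).mul h3).sub (h2.mul h4)).congr_deriv ?_
    simp only [mab]; simp
  have hbd : ∀ a ∈ Icc 0 h, ∀ b ∈ Icc 0 h, ‖mab a b‖ ≤ D := by
    intro a ha b hb
    have ht := habs a ha b hb
    have e1 := bk _ ht
    have e2 := bk' _ ht
    have e3 := bk'' _ ht
    have e4 := bpq a b
    have e5 := bp a
    have e6 := bq b
    have e7 := hn (b - a)
    rw [Real.norm_eq_abs]
    have t1 : |2 * (- q' b) * p' a * k (b - a)| ≤ 2 * A * L^2 := by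
      simp only [abs_mul, abs_neg, abs_two]
      have : |q' b| * |p' a| ≤ L * L := mul_le_mul e6 e5 (abs_nonneg _) hL
      have := mul_le_mul this e1 (abs_nonneg _) (by positivity)
      nlinarith
    have t2 : |2 * (p a - q b) * p' a * k' (b - a)| ≤ 2 * A' * L^2 := by
      simp only [abs_mul, abs_two]
      have : |p a - q b| * |p' a| ≤ (L * n (b - a)) * L := mul_le_mul e4 e5 (abs_nonneg _) (by positivity)
      have h1 := mul_le_mul_of_nonneg_right this (abs_nonneg (k' (b-a)))
      have h2 := mul_le_mul_of_nonneg_left e2 (by positivity : 0 ≤ L^2)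
      nlinarith
    have t3 : |2 * (p a - q b) * (-q' b) * k' (b - a)| ≤ 2 * A' * L^2 := by
      simp only [abs_mul, abs_two, abs_neg]
      have : |p a - q b| * |q' b| ≤ (L * n (b - a)) * L := mul_le_mul e4 e6 (abs_nonneg _) (by positivity)
      have h1 := mul_le_mul_of_nonneg_right this (abs_nonneg (k' (b-a)))
      have h2 := mul_le_mul_of_nonneg_left e2 (by positivity : 0 ≤ L^2)
      nlinarith
    have t4 : |(p a - q b)^2 * k'' (b - a)| ≤ A'' * L^2 := by
      simp only [abs_mul, abs_pow]
      have : |p a - q b|^2 ≤ (L * n (b - a))^2 := pow_le_pow_left₀ (abs_nonneg _) e4 2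
      have h1 := mul_le_mul_of_nonneg_right this (abs_nonneg (k'' (b-a)))
      have h2 := mul_le_mul_of_nonneg_left e3 (by positivity : 0 ≤ L^2)
      nlinarith
    have := abs_sub (2 * (- q' b) * p' a * k (b - a)
      + 2 * (p a - q b) * p' a * k' (b - a))
      (2 * (p a - q b) * (- q' b) * k' (b - a) + (p a - q b)^2 * k'' (b - a))
    have h1 := abs_add_le (2 * (- q' b) * p' a * k (b - a)) (2 * (p a - q b) * p' a * k' (b - a))
    have h2 := abs_add_le (2 * (p a - q b) * (- q' b) * k' (b - a)) ((p a - q b)^2 * k'' (b - a))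
    simp only [mab, hD]
    linarith
  have hθ' : ∀ a ∈ Icc 0 h, ‖ma a h - ma a 0‖ ≤ D * h := by
    intro a ha
    have := (convex_Icc 0 h).norm_image_sub_le_of_norm_hasDerivWithin_le (C := D)
      (fun b hb => (hmab a ha b hb).hasDerivWithinAt) (fun b hb => hbd a ha b hb)
      (left_mem_Icc.2 hh) (right_mem_Icc.2 hh)
    rwa [sub_zero, Real.norm_of_nonneg hh] at this
  have := (convex_Icc 0 h).norm_image_sub_le_of_norm_hasDerivWithin_le (C := D * h)
      (fun a ha => ((hma a ha h (right_mem_Icc.2 hh)).sub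
        (hma a ha 0 (left_mem_Icc.2 hh))).hasDerivWithinAt) (fun a ha => hθ' a ha)
      (left_mem_Icc.2 hh) (right_mem_Icc.2 hh)
  rw [sub_zero h, Real.norm_of_nonneg hh, Real.norm_eq_abs] at this
  simp only [Pi.sub_apply] at this
  have e : (p h - q h)^2 * k (h - h) - (p h - q 0)^2 * k (0 - h) - (p 0 - q h)^2 * k (h - 0)
      + (p 0 - q 0)^2 * k (0 - 0) = (p h - q h)^2 * k (h - h) - (p h - q 0)^2 * k (0 - h)
      - ((p 0 - q h)^2 * k (h - 0) - (p 0 - q 0)^2 * k (0 - 0)) := by ring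
  rw [e]
  refine this.trans (le_of_eq (by ring))

noncomputable def GG (d : ℕ) (s : ℝ) (φ : EE d → ℝ) (x y : EE d) : ℝ :=
  (φ x - φ y)^2 * KK d s (x - y)

noncomputable def Cm (d : ℕ) (s : ℝ) : ℝ :=
  (2 + 4 * ((d:ℝ)+2*s) + ((d:ℝ)+2*s) * (((d:ℝ)+2*s) + 3)) * (3/2 : ℝ) ^ ((d:ℝ)+2*s)

lemma mixedG {d : ℕ} {s : ℝ} (hs0 : 0 < s) {φ : EE d → ℝ} (hφ : ContDiff ℝ 1 φ)
    {L : ℝ} (hL : 0 ≤ L) (hLip : ∀ x y, |φ x - φ y| ≤ L * ‖x - y‖)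
    {v : EE d} (hv : ‖v‖ = 1) (hdv : ∀ x, |fderiv ℝ φ x v| ≤ L) {h : ℝ} (hh : 0 < h) {x y : EE d} (hz : 3 * h ≤ ‖x - y‖) :
    |GG d s φ (x - h • v) (y - h • v) - GG d s φ (x - h • v) y - GG d s φ x (y - h • v)
      + GG d s φ x y| ≤ h^2 * (Cm d s * L^2 * KK d s (x - y)) := by
  set q : ℝ := (d:ℝ) + 2 * s with hq
  have hq0 : 0 < q := by positivity
  set z := x - y with hzdef
  set N : ℝ → ℝ := fun t => ‖z + t • v‖^2 with hN
  have hNf : ∀ t, N t = ‖z‖^2 + 2 * t * inner ℝ z v + t^2 := by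
    intro t
    simp only [hN]
    rw [norm_add_sq_real, norm_smul, hv, real_inner_smul_right, mul_one, Real.norm_eq_abs, sq_abs]
    ring
  set N' : ℝ → ℝ := fun t => 2 * inner ℝ z v + 2 * t with hN'
  have hNd : ∀ t, HasDerivAt N (N' t) t := by
    intro t
    have : N = fun t => ‖z‖^2 + 2 * t * inner ℝ z v + t^2 := funext hNf
    rw [this]
    have h1 : HasDerivAt (fun t : ℝ => 2 * t * inner ℝ z v) (2 * 1 * inner ℝ z v) t :=
      ((hasDerivAt_id t).const_mul 2).mul_const _
    have h2 : HasDerivAt (fun t : ℝ => t^2) (2 * t) t := by simpa using hasDerivAt_pow 2 t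
    refine ((h1.const_add (‖z‖^2)).add h2).congr_deriv ?_
    simp only [hN']; ring
  have hN'd : ∀ t, HasDerivAt N' 2 t := by
    intro t
    have := ((hasDerivAt_id t).const_mul 2).const_add (2 * inner ℝ z v)
    exact this.congr_deriv (by simp)
  have hN'b : ∀ t, |N' t| ≤ 2 * ‖z + t • v‖ := by
    intro t
    have : N' t = 2 * inner ℝ (z + t • v) v := by
      simp only [hN', inner_add_left, real_inner_smul_left, real_inner_self_eq_norm_sq, hv]; ring
    rw [this, abs_mul, abs_two]
    have := abs_real_inner_le_norm (z + t • v) v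
    rw [hv, mul_one] at this
    linarith
  have hlow : ∀ t, |t| ≤ h → 2/3 * ‖z‖ ≤ ‖z + t • v‖ := by
    intro t ht
    have h1 : ‖z‖ ≤ ‖z + t • v‖ + ‖t • v‖ := by
      have := norm_sub_le (z + t • v) (t • v); simpa using this
    rw [norm_smul, hv, mul_one, Real.norm_eq_abs] at h1
    linarith
  have hzpos : 0 < ‖z‖ := by linarith
  have hnpos : ∀ t, |t| ≤ h → 0 < ‖z + t • v‖ := fun t ht => by linarith [hlow t ht]
  have hNpos : ∀ t, |t| ≤ h → 0 < N t := fun t ht => by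
    have := hnpos t ht; simp only [hN]; positivity
  set k : ℝ → ℝ := fun t => N t ^ (-q/2) with hk
  set k' : ℝ → ℝ := fun t => N' t * (-q/2) * N t ^ (-q/2 - 1) with hk'
  set k'' : ℝ → ℝ := fun t => 2 * (-q/2) * N t ^ (-q/2 - 1)
    + N' t * (-q/2) * (N' t * (-q/2-1) * N t ^ (-q/2 - 1 - 1)) with hk''
  have hNr : ∀ t (e : ℝ), N t ^ e = ‖z + t • v‖ ^ (2 * e) := by
    intro t e
    simp only [hN]
    rw [← Real.rpow_natCast, ← Real.rpow_mul (norm_nonneg _)]; norm_num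
  have hkK : ∀ t, KK d s (z + t • v) = k t := by
    intro t
    simp only [hk, hNr, KK]
    rw [← Real.rpow_neg (norm_nonneg _)]
    congr 1; ring
  have hA : ∀ t, |t| ≤ h → ‖z + t • v‖ ^ (-q) ≤ (3/2 : ℝ) ^ q * KK d s z := by
    intro t ht
    have h1 : ‖z + t • v‖ ^ (-q) ≤ (2/3 * ‖z‖) ^ (-q) :=
      Real.rpow_le_rpow_of_nonpos (by positivity) (hlow t ht) (by linarith)
    refine h1.trans (le_of_eq ?_)
    rw [Real.mul_rpow (by norm_num) (norm_nonneg _), KK, ← hq, Real.rpow_neg (norm_nonneg z),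
      Real.rpow_neg (by norm_num), ← Real.inv_rpow (by norm_num)]
    norm_num
  have key := mixed1D (p := fun a => φ (x - a • v)) (q := fun b => φ (y - b • v))
    (p' := fun a => - fderiv ℝ φ (x - a • v) v) (q' := fun b => - fderiv ℝ φ (y - b • v) v)
    (k := k) (k' := k') (k'' := k'') (n := fun t => ‖z + t • v‖) (h := h) (L := L)
    (A := (3/2 : ℝ) ^ q * KK d s z) (A' := q * ((3/2 : ℝ) ^ q * KK d s z))
    (A'' := q * (q + 3) * ((3/2 : ℝ) ^ q * KK d s z)) hh.le hL ?_ ?_ ?_ ?_ ?_ ?_ ?_ ?_ ?_ ?_ ?_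
  · have g1 : ∀ a b : ℝ, (φ (x - a • v) - φ (y - b • v))^2 * k (b - a)
        = GG d s φ (x - a • v) (y - b • v) := by
      intro a b
      rw [GG, ← hkK]
      congr 2
      rw [hzdef, sub_smul]; abel
    beta_reduce at key
    rw [g1 h h, g1 h 0, g1 0 h, g1 0 0] at key
    simp only [zero_smul, sub_zero] at key
    refine key.trans (le_of_eq ?_)
    rw [Cm, ← hq]; ring
  · intro a
    have h1 : HasDerivAt (fun a : ℝ => x - a • v) (-v) a := by
      simpa using ((hasDerivAt_id a).smul_const v).const_sub x
    have h2 := (hφ.differentiable (by simp) (x - a • v)).hasFDerivAt.comp_hasDerivAt a h1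
    exact h2.congr_deriv (by simp)
  · intro a
    have h1 : HasDerivAt (fun a : ℝ => y - a • v) (-v) a := by
      simpa using ((hasDerivAt_id a).smul_const v).const_sub y
    have h2 := (hφ.differentiable (by simp) (y - a • v)).hasFDerivAt.comp_hasDerivAt a h1
    exact h2.congr_deriv (by simp)
  · intro t ht
    exact (hNd t).rpow_const (Or.inl (hNpos t ht).ne')
  · intro t ht
    have h1 := (hNd t).rpow_const (p := -q/2 - 1) (Or.inl (hNpos t ht).ne')
    exact ((hN'd t).mul_const (-q/2)).mul h1
  · intro a; rw [abs_neg]; exact hdv _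
  · intro a; rw [abs_neg]; exact hdv _
  · intro t; exact norm_nonneg _
  · intro a b
    refine (hLip _ _).trans (le_of_eq ?_)
    congr 2
    rw [hzdef, sub_smul]; abel
  · intro t ht
    rw [← hkK, abs_of_nonneg (KK_nonneg d s _)]
    refine le_trans (le_of_eq ?_) (hA t ht)
    rw [KK, Real.rpow_neg (norm_nonneg _)]
  · intro t ht
    have hn := hnpos t ht
    have e : |k' t| = |N' t| * (q/2) * ‖z + t • v‖ ^ (-q - 2) := by
      simp only [hk', hNr, abs_mul]
      rw [abs_of_nonneg (Real.rpow_nonneg hn.le _), neg_div, abs_neg, abs_of_pos (by positivity : 0 < q/2)]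
      congr 2; ring
    have e2 : ‖z + t • v‖ ^ (-q - 2) * (‖z + t • v‖ * ‖z + t • v‖) = ‖z + t • v‖ ^ (-q) := by
      rw [← pow_two, ← Real.rpow_natCast, ← Real.rpow_add hn]; congr 1; push_cast; ring
    rw [e]
    have b := hN'b t
    have hpw : 0 ≤ ‖z + t • v‖ ^ (-q - 2) := Real.rpow_nonneg hn.le _
    calc |N' t| * (q/2) * ‖z + t • v‖ ^ (-q - 2) * ‖z + t • v‖
        ≤ (2 * ‖z + t • v‖) * (q/2) * ‖z + t • v‖ ^ (-q - 2) * ‖z + t • v‖ := by gcongr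
      _ = q * (‖z + t • v‖ ^ (-q - 2) * (‖z + t • v‖ * ‖z + t • v‖)) := by ring
      _ ≤ _ := by rw [e2]; exact mul_le_mul_of_nonneg_left (hA t ht) hq0.le
  · intro t ht
    have hn := hnpos t ht
    have e2 : ‖z + t • v‖ ^ (2 * (-q/2 - 1)) * ‖z + t • v‖^2 = ‖z + t • v‖ ^ (-q) := by
      rw [← Real.rpow_natCast, ← Real.rpow_add hn]; congr 1; push_cast; ring
    have e3 : ‖z + t • v‖ ^ (2 * (-q/2 - 1 - 1)) * ‖z + t • v‖^4 = ‖z + t • v‖ ^ (-q) := by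
      rw [← Real.rpow_natCast, ← Real.rpow_add hn]; congr 1; push_cast; ring
    have b := hN'b t
    have hp1 : 0 ≤ ‖z + t • v‖ ^ (2 * (-q/2 - 1)) := Real.rpow_nonneg hn.le _
    have hp2 : 0 ≤ ‖z + t • v‖ ^ (2 * (-q/2 - 1 - 1)) := Real.rpow_nonneg hn.le _
    have b1 : |k'' t| ≤ q * ‖z + t • v‖ ^ (2 * (-q/2 - 1))
        + (2 * ‖z + t • v‖) * (q/2) * ((2 * ‖z + t • v‖) * (q/2+1) * ‖z + t • v‖ ^ (2 * (-q/2 - 1 - 1))) := by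
      simp only [hk'', hNr]
      refine (abs_add_le _ _).trans (add_le_add ?_ ?_)
      · rw [abs_mul, abs_of_nonneg hp1]
        refine mul_le_mul_of_nonneg_right (le_of_eq ?_) hp1
        rw [abs_of_neg (by linarith)]; ring
      · simp only [abs_mul, abs_of_nonneg hp2]
        have a1 : |-q/2| = q/2 := by rw [abs_of_neg (by linarith)]; ring
        have a2 : |-q/2-1| = q/2+1 := by rw [abs_of_neg (by linarith)]; ring
        rw [a1, a2]
        gcongr
    calc |k'' t| * ‖z + t • v‖^2 ≤ _ := mul_le_mul_of_nonneg_right b1 (by positivity)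
      _ = q * (‖z + t • v‖ ^ (2 * (-q/2 - 1)) * ‖z + t • v‖^2)
        + q * (q+2) * (‖z + t • v‖ ^ (2 * (-q/2 - 1 - 1)) * ‖z + t • v‖^4) := by ring
      _ = q * (q + 3) * ‖z + t • v‖ ^ (-q) := by rw [e2, e3]; ring
      _ ≤ _ := mul_le_mul_of_nonneg_left (hA t ht) (by positivity)

instance EEri (d : ℕ) : (volume : Measure (EE d × EE d)).IsAddRightInvariant := by
  rw [Measure.volume_eq_prod]; infer_instance

lemma int4 {X : Type*} [MeasurableSpace X] {μ : Measure X} {f1 f2 f3 f4 : X → ℝ} (c : ℝ)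
    (h1 : Integrable f1 μ) (h2 : Integrable f2 μ) (h3 : Integrable f3 μ) (h4 : Integrable f4 μ) :
    ∫ x, c * (f1 x - f2 x - f3 x + f4 x) ∂μ
      = c * (∫ x, f1 x ∂μ - ∫ x, f2 x ∂μ - ∫ x, f3 x ∂μ + ∫ x, f4 x ∂μ) := by
  have h12 : Integrable (fun x => f1 x - f2 x) μ := h1.sub h2
  have h123 : Integrable (fun x => f1 x - f2 x - f3 x) μ := h12.sub h3
  rw [integral_const_mul, integral_add h123 h4, integral_sub h12 h3, integral_sub h1 h2]

lemma int6 {X : Type*} [MeasurableSpace X] {μ : Measure X} {f1 f2 f3 f4 f5 f6 : X → ℝ} (a b c : ℝ)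
    (h1 : Integrable f1 μ) (h2 : Integrable f2 μ) (h3 : Integrable f3 μ) (h4 : Integrable f4 μ)
    (h5 : Integrable f5 μ) (h6 : Integrable f6 μ) :
    ∫ x, c * (a * (f1 x + f2 x) + b * (f3 x + f4 x + f5 x + f6 x)) ∂μ
      = c * (a * (∫ x, f1 x ∂μ + ∫ x, f2 x ∂μ) + b * (∫ x, f3 x ∂μ + ∫ x, f4 x ∂μ
        + ∫ x, f5 x ∂μ + ∫ x, f6 x ∂μ)) := by
  have h12 : Integrable (fun x => f1 x + f2 x) μ := h1.add h2
  have h34 : Integrable (fun x => f3 x + f4 x) μ := h3.add h4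
  have h345 : Integrable (fun x => f3 x + f4 x + f5 x) μ := h34.add h5
  have h3456 : Integrable (fun x => f3 x + f4 x + f5 x + f6 x) μ := h345.add h6
  rw [integral_const_mul, integral_add (h12.const_mul a) (h3456.const_mul b), integral_const_mul,
    integral_const_mul, integral_add h1 h2, integral_add h345 h6, integral_add h34 h5,
    integral_add h3 h4]

lemma int_le {X : Type*} [MeasurableSpace X] {μ : Measure X} {f g : X → ℝ} (hg : Integrable g μ)
    (h0 : ∀ x, 0 ≤ g x) (h : ∀ x, f x ≤ g x) : ∫ x, f x ∂μ ≤ ∫ x, g x ∂μ := by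
  by_cases hf : Integrable f μ
  · exact integral_mono hf hg h
  · rw [integral_undef hf]; exact integral_nonneg h0

noncomputable def bi {d : ℕ} (x₀ : EE d) (R : ℝ) (x : EE d) : ℝ :=
  (ball x₀ R).indicator (fun _ => (1:ℝ)) x

lemma bi_nonneg {d : ℕ} (x₀ : EE d) (R : ℝ) (x : EE d) : 0 ≤ bi x₀ R x :=
  indicator_nonneg (fun _ _ => zero_le_one) _

lemma bi_one {d : ℕ} {x₀ : EE d} {R : ℝ} {x : EE d} (h : x ∈ ball x₀ R) : bi x₀ R x = 1 := by
  simp only [bi, indicator_of_mem h]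

lemma bi_zero {d : ℕ} {x₀ : EE d} {R : ℝ} {x : EE d} (h : x ∉ ball x₀ R) : bi x₀ R x = 0 := by
  simp only [bi, indicator_of_notMem h]

lemma bi_meas {d : ℕ} (x₀ : EE d) (R : ℝ) : Measurable (bi x₀ R) :=
  measurable_const.indicator measurableSet_ball

noncomputable def JJ (d : ℕ) (s : ℝ) (u : EE d → ℝ) (x₀ : EE d) (R : ℝ) : ℝ :=
  ∫ p : EE d × EE d, (bi x₀ R p.1 * (u p.1 - u p.2)^2) * KK d s (p.1 - p.2)

lemma JJ_int {d : ℕ} (hd : 1 ≤ d) {s : ℝ} (hs0 : 0 < s) (hs1 : s < 1/2)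
    {u : EE d → ℝ} (hu : LL u) (x₀ : EE d) (R : ℝ) :
    Integrable (fun p : EE d × EE d =>
      (bi x₀ R p.1 * (u p.1 - u p.2)^2) * KK d s (p.1 - p.2)) := by
  obtain ⟨C, hC0, hC⟩ := hu.2.2 (‖x₀‖ + R)
  obtain ⟨M, hM0, hM⟩ := hu.2.1
  have huc := hu.1
  have hbm := bi_meas x₀ R
  refine prod_int d hd s hs0 hs1 (‖x₀‖ + R) (2 * M * C)
    (fun p => bi x₀ R p.1 * (u p.1 - u p.2)^2) (by fun_prop) fun x y => ?_
  have hm : 0 ≤ min ‖x - y‖ 1 := le_min (norm_nonneg _) zero_le_one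
  have i1 := ind_nonneg d (‖x₀‖ + R) x
  have i2 := ind_nonneg d (‖x₀‖ + R) y
  by_cases hx : x ∈ ball x₀ R
  · have hxn : ‖x‖ ≤ ‖x₀‖ + R := by
      have h1 : ‖x - x₀‖ < R := by simpa [dist_eq_norm] using hx
      have h2 := norm_sub_norm_le x x₀
      linarith
    simp only [bi_one hx, one_mul]
    rw [pow_two, abs_mul, ind_eq_one hxn, mul_assoc]
    refine mul_le_mul ((abs_sub _ _).trans (by linarith [hM x, hM y])) ((hC x hxn y).trans ?_)
      (abs_nonneg _) (by positivity)
    refine mul_le_mul_of_nonneg_left ?_ hC0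
    nlinarith
  · simp only [bi_zero hx, zero_mul, abs_zero]
    positivity

lemma shift_int {d : ℕ} (F G : EE d × EE d → ℝ) (b : EE d × EE d) :
    ∫ p, F (p + b) * G p = ∫ p, F p * G (p - b) := by
  rw [← integral_sub_right_eq_self (fun p => F (p + b) * G p) b]
  simp

lemma ibp {d : ℕ} {u : EE d → ℝ} (hu : LL u) {G : EE d → EE d → ℝ}
    (hG : Integrable (fun p : EE d × EE d => G p.1 p.2)) (a : EE d) :
    ∫ p : EE d × EE d, ((u (p.1 + a) - u p.1) * (u (p.2 + a) - u p.2)) * G p.1 p.2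
    = ∫ p : EE d × EE d, -(1/2) * ((u p.1 - u p.2)^2 * (G (p.1 - a) (p.2 - a) - G (p.1 - a) p.2
      - G p.1 (p.2 - a) + G p.1 p.2)) := by
  obtain ⟨M, hM0, hM⟩ := hu.2.1
  have huc := hu.1
  let F : EE d × EE d → ℝ := fun p => (u p.1 - u p.2)^2
  have hFc : Continuous F := by simp only [F]; fun_prop
  have hFb : ∀ p, ‖F p‖ ≤ (2*M)^2 := by
    intro p
    simp only [F]
    rw [norm_pow, Real.norm_eq_abs]
    exact pow_le_pow_left₀ (abs_nonneg _) ((abs_sub _ _).trans (by linarith [hM p.1, hM p.2])) 2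
  let G' : EE d × EE d → ℝ := fun p => G p.1 p.2
  have i1 : ∀ b : EE d × EE d, Integrable (fun p => F (p + b) * G' p) := fun b =>
    hG.bdd_mul (hFc.comp (continuous_add_const b)).aestronglyMeasurable
      (Eventually.of_forall fun p => hFb _)
  have i2 : ∀ b : EE d × EE d, Integrable (fun p => F p * G' (p - b)) := fun b =>
    (hG.comp_sub_right b).bdd_mul hFc.aestronglyMeasurable
      (Eventually.of_forall fun p => hFb _)
  have L : ∫ p : EE d × EE d, ((u (p.1 + a) - u p.1) * (u (p.2 + a) - u p.2)) * G p.1 p.2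
      = -(1/2) * (((∫ p, F (p + (a, a)) * G' p) - (∫ p, F (p + (a, 0)) * G' p))
        - (∫ p, F (p + (0, a)) * G' p) + ∫ p, F (p + (0,0)) * G' p) := by
    rw [← int4 _ (i1 _) (i1 _) (i1 _) (i1 _)]
    congr 1; ext p
    simp only [F, G', Prod.fst_add, Prod.snd_add, add_zero]
    ring
  have R : ∫ p : EE d × EE d, -(1/2) * ((u p.1 - u p.2)^2 * (G (p.1 - a) (p.2 - a)
      - G (p.1 - a) p.2 - G p.1 (p.2 - a) + G p.1 p.2))
      = -(1/2) * (((∫ p, F p * G' (p - (a, a))) - (∫ p, F p * G' (p - (a, 0))))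
        - (∫ p, F p * G' (p - (0, a))) + ∫ p, F p * G' (p - (0,0))) := by
    rw [← int4 _ (i2 _) (i2 _) (i2 _) (i2 _)]
    congr 1; ext p
    simp only [F, G', Prod.fst_sub, Prod.snd_sub, sub_zero]
    ring
  rw [L, R, shift_int, shift_int, shift_int, shift_int]

noncomputable def GT (d : ℕ) (s : ℝ) (φ : EE d → ℝ) (r : ℝ) (p : EE d × EE d) : ℝ :=
  {p : EE d × EE d | ‖p.1 - p.2‖ < r}.indicator (fun p => GG d s φ p.1 p.2) p

lemma GG_nonneg (d : ℕ) (s : ℝ) (φ : EE d → ℝ) (x y : EE d) : 0 ≤ GG d s φ x y :=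
  mul_nonneg (sq_nonneg _) (KK_nonneg d s _)

lemma GT_nonneg (d : ℕ) (s : ℝ) (φ : EE d → ℝ) (r : ℝ) (p : EE d × EE d) : 0 ≤ GT d s φ r p :=
  indicator_nonneg (fun _ _ => GG_nonneg d s φ _ _) _

lemma GT_eq {d : ℕ} {s : ℝ} {φ : EE d → ℝ} {r : ℝ} {x y : EE d} (h : ‖x - y‖ < r) :
    GT d s φ r (x, y) = GG d s φ x y := by
  unfold GT
  rw [indicator_of_mem (by exact h)]

lemma near_meas (d : ℕ) (r : ℝ) : MeasurableSet {p : EE d × EE d | ‖p.1 - p.2‖ < r} :=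
  measurableSet_lt (by fun_prop) measurable_const

lemma GT_tendsto {d : ℕ} (hd : 1 ≤ d) {s : ℝ} (hs0 : 0 < s) (hs1 : s < 1/2)
    {φ : EE d → ℝ} (hφ : LL φ) {r : ℝ} (hr : ∀ x, r < ‖x‖ → φ x = 0) :
    Tendsto (fun h : ℝ => ∫ p, GT d s φ (4*h) p) (𝓝[>] 0) (𝓝 0) := by
  have hG := G_int hd hs0 hs1 hφ hr
  suffices H : Tendsto (fun h : ℝ => ∫ p, GT d s φ (4*h) p) (𝓝[>] 0)
      (𝓝 (∫ p : EE d × EE d, (0:ℝ))) by simpa using H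
  refine tendsto_integral_filter_of_dominated_convergence _
    (Eventually.of_forall fun h => ?_) (Eventually.of_forall fun h => ?_) hG ?_
  · exact (hG.indicator (near_meas d (4*h))).1
  · refine Eventually.of_forall fun p => ?_
    rw [Real.norm_of_nonneg (GT_nonneg d s φ _ p)]
    exact indicator_le_self' (fun _ _ => GG_nonneg d s φ _ _) p
  · refine Eventually.of_forall fun p => ?_
    refine tendsto_const_nhds.congr' ?_
    by_cases hp : p.1 = p.2
    · refine Eventually.of_forall fun h => ?_
      simp only [GT, indicator, GG, hp]; simp
    · have h0 : 0 < ‖p.1 - p.2‖ := norm_pos_iff.2 (sub_ne_zero.2 hp)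
      have : ∀ᶠ h : ℝ in 𝓝[>] 0, h < ‖p.1 - p.2‖ / 4 :=
        nhdsWithin_le_nhds (Iio_mem_nhds (by positivity))
      filter_upwards [this] with h hh
      rw [GT, indicator_of_notMem]
      simp only [mem_ofPred_eq, not_lt]; linarith

set_option maxHeartbeats 1000000 in
lemma rhs_bound {d : ℕ} (hd : 1 ≤ d) {s : ℝ} (hs0 : 0 < s) (hs1 : s < 1/2)
    {u : EE d → ℝ} (hu : LL u) {φ : EE d → ℝ} (hφL : LL φ) (hφ : ContDiff ℝ 1 φ)
    {x₀ : EE d} {ρ : ℝ} (hsup : ∀ x, x ∉ ball x₀ (2*ρ) → φ x = 0)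
    {L : ℝ} (hL : 0 ≤ L) (hLip : ∀ x y, |φ x - φ y| ≤ L * ‖x - y‖)
    {v : EE d} (hv : ‖v‖ = 1) (hdv : ∀ x, |fderiv ℝ φ x v| ≤ L)
    {Λ : ℝ} (hΛ : ∀ x ∈ ball x₀ (4*ρ), ∀ y, |u x - u y| ≤ Λ * ‖x - y‖)
    {h : ℝ} (hh : 0 < h) (hhρ : h ≤ ρ) :
    ∫ p : EE d × EE d, ((u (p.1 + h • v) - u p.1) * (u (p.2 + h • v) - u p.2)) *
      ((φ p.1 - φ p.2)^2 * KK d s (p.1 - p.2))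
    ≤ h^2 * (Cm d s * L^2 * JJ d s u x₀ (4*ρ) + 18 * Λ^2 * ∫ p, GT d s φ (4*h) p) := by
  have hr : ∀ x, ‖x₀‖ + 2*ρ < ‖x‖ → φ x = 0 := by
    intro x hx
    refine hsup x fun hx' => ?_
    have h1 : ‖x - x₀‖ < 2*ρ := by simpa [dist_eq_norm] using hx'
    have h2 := norm_sub_norm_le x x₀
    linarith
  have hG := G_int hd hs0 hs1 hφL hr
  have hGT : Integrable (GT d s φ (4*h)) := hG.indicator (near_meas d (4*h))
  have e := ibp hu (G := GG d s φ) hG (h • v)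
  have hJ := JJ_int hd hs0 hs1 hu x₀ (4*ρ)
  have hJ2 : Integrable (fun p : EE d × EE d =>
      (bi x₀ (4*ρ) p.2 * (u p.2 - u p.1)^2) * KK d s (p.2 - p.1)) :=
    (swap_mp d).integrable_comp_of_integrable hJ
  have eJ2 : ∫ p : EE d × EE d, (bi x₀ (4*ρ) p.2 * (u p.2 - u p.1)^2) * KK d s (p.2 - p.1)
      = JJ d s u x₀ (4*ρ) :=
    (swap_mp d).integral_comp (MeasurableEquiv.prodComm.measurableEmbedding)
      (fun p : EE d × EE d => (bi x₀ (4*ρ) p.1 * (u p.1 - u p.2)^2) * KK d s (p.1 - p.2))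
  set a := h • v with ha
  have han : ‖a‖ = h := by rw [ha, norm_smul, hv, Real.norm_of_nonneg hh.le, mul_one]
  have g1 := hGT.comp_sub_right (a, a)
  have g2 := hGT.comp_sub_right (a, 0)
  have g3 := hGT.comp_sub_right (0, a)
  have eg : ∀ b, ∫ p, GT d s φ (4*h) (p - b) = ∫ p, GT d s φ (4*h) p := fun b =>
    integral_sub_right_eq_self _ b
  have total : ∫ p : EE d × EE d, h^2 * (1/2 * (Cm d s * L^2) *
        ((bi x₀ (4*ρ) p.1 * (u p.1 - u p.2)^2) * KK d s (p.1 - p.2)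
          + (bi x₀ (4*ρ) p.2 * (u p.2 - u p.1)^2) * KK d s (p.2 - p.1))
        + 9/2 * Λ^2 * (GT d s φ (4*h) (p - (a,a)) + GT d s φ (4*h) (p - (a,0))
          + GT d s φ (4*h) (p - (0,a)) + GT d s φ (4*h) p))
      = h^2 * (Cm d s * L^2 * JJ d s u x₀ (4*ρ) + 18 * Λ^2 * ∫ p, GT d s φ (4*h) p) := by
    rw [int6 _ _ _ hJ hJ2 g1 g2 g3 hGT, eJ2, eg, eg, eg]
    rw [← JJ]; ring
  have toti : Integrable (fun p : EE d × EE d => h^2 * (1/2 * (Cm d s * L^2) *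
        ((bi x₀ (4*ρ) p.1 * (u p.1 - u p.2)^2) * KK d s (p.1 - p.2)
          + (bi x₀ (4*ρ) p.2 * (u p.2 - u p.1)^2) * KK d s (p.2 - p.1))
        + 9/2 * Λ^2 * (GT d s φ (4*h) (p - (a,a)) + GT d s φ (4*h) (p - (a,0))
          + GT d s φ (4*h) (p - (0,a)) + GT d s φ (4*h) p))) :=
    (((hJ.add hJ2).const_mul _).add ((((g1.add g2).add g3).add hGT).const_mul _)).const_mul _
  have e' : ∫ p : EE d × EE d, ((u (p.1 + a) - u p.1) * (u (p.2 + a) - u p.2)) *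
      ((φ p.1 - φ p.2)^2 * KK d s (p.1 - p.2)) = _ := e
  rw [← total, e']
  have hout : ∀ x, x ∉ ball x₀ (4*ρ) → φ x = 0 ∧ φ (x - a) = 0 := by
    intro x hx
    simp only [mem_ball, dist_eq_norm, not_lt] at hx
    constructor
    · apply hsup; simp only [mem_ball, dist_eq_norm, not_lt]; linarith
    · apply hsup; simp only [mem_ball, dist_eq_norm, not_lt]
      have := norm_sub_norm_le (x - x₀) a
      rw [show x - a - x₀ = x - x₀ - a by abel]
      linarith
  have hCm : 0 ≤ Cm d s := by unfold Cm; positivity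
  refine int_le toti (fun p => ?_) ?_
  · have n1 := GT_nonneg d s φ (4*h)
    have b1 := bi_nonneg x₀ (4*ρ)
    have k1 := KK_nonneg d s
    have r1 := b1 p.1
    have r2 := b1 p.2
    have r3 := k1 (p.1 - p.2)
    have r4 := k1 (p.2 - p.1)
    have r5 := n1 (p - (a,a))
    have r6 := n1 (p - (a,0))
    have r7 := n1 (p - (0,a))
    have r8 := n1 p
    positivity
  rintro ⟨x, y⟩
  simp only [Prod.mk_sub_mk, sub_zero]
  have n1 := GT_nonneg d s φ (4*h) (x - a, y - a)
  have n2 := GT_nonneg d s φ (4*h) (x - a, y)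
  have n3 := GT_nonneg d s φ (4*h) (x, y - a)
  have n4 := GT_nonneg d s φ (4*h) (x, y)
  have b1 := bi_nonneg x₀ (4*ρ) x
  have b2 := bi_nonneg x₀ (4*ρ) y
  have k1 := KK_nonneg d s (x - y)
  have k2 := KK_nonneg d s (y - x)
  by_cases hB : x ∈ ball x₀ (4*ρ) ∨ y ∈ ball x₀ (4*ρ)
  · by_cases hxy : 3 * h ≤ ‖x - y‖
    · have hm := mixedG hs0 hφ hL hLip hv hdv hh hxy
      rw [← ha] at hm
      have hm' := (abs_le.1 hm).1
      have hbb : 1 ≤ bi x₀ (4*ρ) x + bi x₀ (4*ρ) y := by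
        rcases hB with hB | hB <;> rw [bi_one hB] <;> linarith
      have q1 : -(1/2) * ((u x - u y)^2 * (GG d s φ (x - a) (y - a) - GG d s φ (x - a) y
          - GG d s φ x (y - a) + GG d s φ x y))
          ≤ 1/2 * ((u x - u y)^2 * (h^2 * (Cm d s * L^2 * KK d s (x - y)))) := by
        have := mul_le_mul_of_nonneg_left hm' (sq_nonneg (u x - u y))
        linarith
      have q2 : 1/2 * ((u x - u y)^2 * (h^2 * (Cm d s * L^2 * KK d s (x - y)))) * 1
          ≤ 1/2 * ((u x - u y)^2 * (h^2 * (Cm d s * L^2 * KK d s (x - y)))) *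
            (bi x₀ (4*ρ) x + bi x₀ (4*ρ) y) := mul_le_mul_of_nonneg_left hbb (by positivity)
      have q3 : 0 ≤ h^2 * (9/2 * Λ^2 * (GT d s φ (4*h) (x - a, y - a) + GT d s φ (4*h) (x - a, y)
          + GT d s φ (4*h) (x, y - a) + GT d s φ (4*h) (x, y))) := by positivity
      rw [KK_comm d s y x]
      linarith
    · push Not at hxy
      have hF : (u x - u y)^2 ≤ 9 * Λ^2 * h^2 := by
        have h0 : |u x - u y| ≤ Λ * ‖x - y‖ := by
          rcases hB with hB | hB
          · exact hΛ x hB y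
          · rw [abs_sub_comm, norm_sub_rev]; exact hΛ y hB x
        rw [← sq_abs]
        calc |u x - u y|^2 ≤ (Λ * ‖x - y‖)^2 := pow_le_pow_left₀ (abs_nonneg _) h0 2
          _ = Λ^2 * ‖x - y‖^2 := by ring
          _ ≤ Λ^2 * (3 * h)^2 := by gcongr
          _ = _ := by ring
      have m1 : ‖x - a - (y - a)‖ < 4 * h := by
        rw [show x - a - (y - a) = x - y by abel]; linarith
      have m2 : ‖x - a - y‖ < 4 * h := by
        rw [show x - a - y = x - y - a by abel]
        have := norm_sub_le (x - y) a
        linarith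
      have m3 : ‖x - (y - a)‖ < 4 * h := by
        rw [show x - (y - a) = x - y + a by abel]
        have := norm_add_le (x - y) a
        linarith
      have m4 : ‖x - y‖ < 4 * h := by linarith
      rw [GT_eq m1, GT_eq m2, GT_eq m3, GT_eq m4] at *
      have q3 : 0 ≤ h^2 * (1/2 * (Cm d s * L^2) *
        ((bi x₀ (4*ρ) x * (u x - u y)^2) * KK d s (x - y)
          + (bi x₀ (4*ρ) y * (u y - u x)^2) * KK d s (y - x))) := by positivity
      have q4 := mul_le_mul_of_nonneg_right hF (by positivity : 0 ≤ GG d s φ (x - a) (y - a)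
        + GG d s φ (x - a) y + GG d s φ x (y - a) + GG d s φ x y)
      have q5 : 0 ≤ (u x - u y)^2 * GG d s φ (x - a) (y - a) := by positivity
      have q6 : 0 ≤ (u x - u y)^2 * GG d s φ x y := by positivity
      have q7 : 0 ≤ (u x - u y)^2 * GG d s φ x (y - a) := by positivity
      have q8 : 0 ≤ (u x - u y)^2 * GG d s φ (x - a) y := by positivity
      linarith
  · push Not at hB
    have o1 := hout x hB.1
    have o2 := hout y hB.2
    have : -(1/2) * ((u x - u y)^2 * (GG d s φ (x - a) (y - a) - GG d s φ (x - a) y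
          - GG d s φ x (y - a) + GG d s φ x y)) = 0 := by
      simp [GG, o1.1, o1.2, o2.1, o2.2]
    rw [this]
    positivity

lemma abs_sub_self_eq (a b : ℝ) :
    |a * b| - a * b = 2 * (max a 0 * max (-b) 0) + 2 * (max (-a) 0 * max b 0) := by
  rcases le_total a 0 with ha | ha <;> rcases le_total b 0 with hb | hb
  · rw [abs_of_nonneg (mul_nonneg_of_nonpos_of_nonpos ha hb), max_eq_right ha, max_eq_right hb]; ring
  · rw [abs_of_nonpos (mul_nonpos_of_nonpos_of_nonneg ha hb), max_eq_right ha,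
      max_eq_left (by linarith : 0 ≤ -a), max_eq_left hb]; ring
  · rw [abs_of_nonpos (mul_nonpos_of_nonneg_of_nonpos ha hb), max_eq_right hb,
      max_eq_left (by linarith : 0 ≤ -b), max_eq_left ha]; ring
  · rw [abs_of_nonneg (mul_nonneg ha hb), max_eq_right (by linarith : -a ≤ 0),
      max_eq_right (by linarith : -b ≤ 0)]; ring

lemma cs_int {d : ℕ} {f : EE d → ℝ} (hf : Continuous f) {x₀ : EE d} {R : ℝ}
    (h : ∀ x, x ∉ ball x₀ R → f x = 0) : Integrable f := by
  refine hf.integrable_of_hasCompactSupport ?_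
  refine HasCompactSupport.intro (isCompact_closedBall x₀ R) fun x hx => h x fun hx' => hx ?_
  exact ball_subset_closedBall hx'

lemma pn_lower {d : ℕ} {s : ℝ} (hs0 : 0 < s)
    {φ w : EE d → ℝ} (hφc : Continuous φ) (hφ0 : ∀ x, 0 ≤ φ x) (hw : Continuous w)
    {x₀ : EE d} {ρ : ℝ} (hρ : 0 < ρ) (hsup : ∀ x, x ∉ ball x₀ (2*ρ) → φ x = 0)
    (hI : Integrable (fun p : EE d × EE d =>
      (φ p.1 * φ p.2 * (|w p.1 * w p.2| - w p.1 * w p.2)) * KK d s (p.1 - p.2))) :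
    4 * ((4*ρ)^((d:ℝ)+2*s))⁻¹ * ((∫ x, φ x * max (w x) 0) * (∫ x, φ x * max (-w x) 0)) ≤
    ∫ p : EE d × EE d,
      (φ p.1 * φ p.2 * (|w p.1 * w p.2| - w p.1 * w p.2)) * KK d s (p.1 - p.2) := by
  set κ := ((4*ρ)^((d:ℝ)+2*s))⁻¹ with hκ
  have i1 : Integrable (fun x => φ x * max (w x) 0) :=
    cs_int (by fun_prop) (fun x hx => by rw [hsup x hx, zero_mul])
  have i2 : Integrable (fun x => φ x * max (-w x) 0) :=
    cs_int (by fun_prop) (fun x hx => by rw [hsup x hx, zero_mul])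
  have j1 := i1.mul_prod i2
  have j2 := i2.mul_prod i1
  have e1 := integral_prod_mul (μ := (volume : Measure (EE d))) (ν := (volume : Measure (EE d)))
    (fun x => φ x * max (w x) 0) (fun x => φ x * max (-w x) 0)
  have e2 := integral_prod_mul (μ := (volume : Measure (EE d))) (ν := (volume : Measure (EE d)))
    (fun x => φ x * max (-w x) 0) (fun x => φ x * max (w x) 0)
  have tot : ∫ p : EE d × EE d, (2 * κ) * ((φ p.1 * max (w p.1) 0) * (φ p.2 * max (-w p.2) 0)
      + (φ p.1 * max (-w p.1) 0) * (φ p.2 * max (w p.2) 0)) =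
      4 * κ * ((∫ x, φ x * max (w x) 0) * (∫ x, φ x * max (-w x) 0)) := by
    rw [integral_const_mul, Measure.volume_eq_prod, integral_add j1 j2, e1, e2]; ring
  rw [← tot]
  refine integral_mono ((j1.add j2).const_mul _) hI ?_
  rintro ⟨x, y⟩
  simp only
  have hk : φ x * φ y * (|w x * w y| - w x * w y) * κ ≤
      φ x * φ y * (|w x * w y| - w x * w y) * KK d s (x - y) := by
    by_cases hx : x ∈ ball x₀ (2*ρ)
    · by_cases hy : y ∈ ball x₀ (2*ρ)
      · by_cases hxy : x = y
        · subst hxy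
          rw [abs_of_nonneg (mul_self_nonneg (w x))]; simp
        · refine mul_le_mul_of_nonneg_left ?_ (mul_nonneg (mul_nonneg (hφ0 x) (hφ0 y))
            (sub_nonneg.2 (le_abs_self _)))
          rw [hκ, KK]
          have h0 : 0 < ‖x - y‖ := norm_pos_iff.2 (sub_ne_zero.2 hxy)
          have h1 : ‖x - y‖ ≤ 4 * ρ := by
            simp only [mem_ball, dist_eq_norm] at hx hy
            have := norm_sub_le (x - x₀) (y - x₀)
            rw [sub_sub_sub_cancel_right] at this
            linarith
          have : 0 ≤ (d:ℝ) + 2 * s := by positivity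
          refine inv_anti₀ (Real.rpow_pos_of_pos h0 _) (Real.rpow_le_rpow h0.le h1 this)
      · simp [hsup y hy]
    · simp [hsup x hx]
  refine le_trans (le_of_eq ?_) hk
  rw [abs_sub_self_eq]; ring

lemma dq_tendsto {d : ℕ} {u : EE d → ℝ} (hu : ContDiff ℝ 1 u) (x v : EE d) :
    Tendsto (fun h : ℝ => (u (x + h • v) - u x) / h) (𝓝[>] 0) (𝓝 (fderiv ℝ u x v)) := by
  have h1 := ((hu.differentiable (by simp)) x).hasFDerivAt.hasLineDerivAt v
  have h2 := h1.tendsto_slope_zero_right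
  refine h2.congr fun h => ?_
  simp [div_eq_inv_mul]

lemma part_tendsto {d : ℕ} {u φ : EE d → ℝ} (hu : ContDiff ℝ 1 u) (hφ : Continuous φ)
    (hφ0 : ∀ x, 0 ≤ φ x)
    {x₀ : EE d} {R Λ : ℝ} (hΛ : ∀ x ∈ ball x₀ R, ∀ y, |u x - u y| ≤ Λ * ‖x - y‖)
    (hsup : ∀ x, x ∉ ball x₀ R → φ x = 0) {v : EE d} (hv : ‖v‖ = 1) (σ : ℝ) (hσ : |σ| ≤ 1) :
    Tendsto (fun h : ℝ => ∫ x, φ x * max (σ * ((u (x + h • v) - u x) / h)) 0) (𝓝[>] 0)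
      (𝓝 (∫ x, φ x * max (σ * fderiv ℝ u x v) 0)) := by
  have huc := hu.continuous
  refine tendsto_integral_filter_of_dominated_convergence (fun x => φ x * Λ)
    (Eventually.of_forall fun h => ?_) ?_ ((cs_int hφ hsup).mul_const Λ) ?_
  · have : Continuous fun x => φ x * max (σ * ((u (x + h • v) - u x) / h)) 0 := by fun_prop
    exact this.aestronglyMeasurable
  · filter_upwards [self_mem_nhdsWithin] with h hh
    have hh : 0 < h := hh
    refine Eventually.of_forall fun x => ?_
    rw [norm_mul, Real.norm_of_nonneg (hφ0 x), Real.norm_of_nonneg (le_max_right _ _)]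
    by_cases hx : x ∈ ball x₀ R
    · refine mul_le_mul_of_nonneg_left ?_ (hφ0 x)
      have h1 := hΛ x hx (x + h • v)
      rw [abs_sub_comm] at h1
      simp only [sub_add_cancel_left, norm_neg, norm_smul, hv, mul_one,
        Real.norm_of_nonneg hh.le] at h1
      have h2 : |(u (x + h • v) - u x) / h| ≤ Λ := by
        rw [abs_div, abs_of_pos hh, div_le_iff₀ hh]; exact h1
      have h3 : |σ * ((u (x + h • v) - u x) / h)| ≤ Λ := by
        rw [abs_mul]
        exact (mul_le_of_le_one_left (abs_nonneg _) hσ).trans h2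
      exact max_le ((le_abs_self _).trans h3) ((abs_nonneg _).trans h3)
    · simp [hsup x hx]
  · refine Eventually.of_forall fun x => ?_
    exact (((dq_tendsto hu x v).const_mul σ).max tendsto_const_nhds).const_mul _

lemma PN_bound {d : ℕ} (hd : 1 ≤ d) {s : ℝ} (hs0 : 0 < s) (hs1 : s < 1/2) {c : ℝ} (hc : 0 < c)
    {u F0 g : EE d → ℝ} (hu : ContDiff ℝ 1 u) (hu1 : ∀ x, |u x| ≤ 1)
    (hF : Continuous F0) (hg : Continuous g)
    (heq : ∀ x, c / 2 * (∫ y, (2 * u x - u (x + y) - u (x - y)) / ‖y‖ ^ ((d : ℝ) + 2*s)) = F0 x)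
    (hst : ∀ η : EE d → ℝ, ContDiff ℝ (⊤ : ℕ∞) η → HasCompactSupport η →
      ∫ x, g x * (η x)^2 ≤ c / 2 * ∫ x : EE d, ∫ y : EE d,
        (η x - η y)^2 / ‖x - y‖ ^ ((d : ℝ) + 2*s))
    {α Cα : ℝ} (hα : 0 < α) (hCα : 0 ≤ Cα)
    (hHol : ∀ x y, |F0 y - F0 x - g x * (u y - u x)| ≤ Cα * |u y - u x|^α * |u y - u x|)
    {φ : EE d → ℝ} (hφ : ContDiff ℝ 1 φ) (hφ0 : ∀ x, 0 ≤ φ x) (hφ1 : ∀ x, φ x ≤ 1)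
    {x₀ : EE d} {ρ : ℝ} (hρ : 0 < ρ) (hsup : ∀ x, x ∉ ball x₀ (2*ρ) → φ x = 0)
    {L : ℝ} (hL : 0 ≤ L) (hLip : ∀ x y, |φ x - φ y| ≤ L * ‖x - y‖)
    {v : EE d} (hv : ‖v‖ = 1) (hdv : ∀ x, |fderiv ℝ φ x v| ≤ L) :
    8 * ((4*ρ)^((d:ℝ)+2*s))⁻¹ * ((∫ x, φ x * max (fderiv ℝ u x v) 0)
      * (∫ x, φ x * max (-fderiv ℝ u x v) 0)) ≤ Cm d s * L^2 * JJ d s u x₀ (4*ρ) := by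
  have huL : LL u := LL.of_contDiff hu 1 zero_le_one hu1
  have hφL : LL φ := LL.of_contDiff hφ 1 zero_le_one fun x => by
    rw [abs_of_nonneg (hφ0 x)]; exact hφ1 x
  have hr : ∀ x, ‖x₀‖ + 2*ρ < ‖x‖ → φ x = 0 := by
    intro x hx
    refine hsup x fun hx' => ?_
    have h1 : ‖x - x₀‖ < 2*ρ := by simpa [dist_eq_norm] using hx'
    have h2 := norm_sub_norm_le x x₀
    linarith
  obtain ⟨Λ, hΛ0, hΛ'⟩ := huL.2.2 (‖x₀‖ + 4*ρ)
  have hΛ : ∀ x ∈ ball x₀ (4*ρ), ∀ y, |u x - u y| ≤ Λ * ‖x - y‖ := by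
    intro x hx y
    have h1 : ‖x - x₀‖ < 4*ρ := by simpa [dist_eq_norm] using hx
    have h2 := norm_sub_norm_le x x₀
    exact (hΛ' x (by linarith) y).trans (mul_le_mul_of_nonneg_left (min_le_left _ _) hΛ0)
  have hΛ2 : ∀ x ∈ ball x₀ (2*ρ), ∀ y, |u x - u y| ≤ Λ * ‖x - y‖ := fun x hx =>
    hΛ x (ball_subset_ball (by linarith) hx)
  have T1 := part_tendsto hu hφ.continuous hφ0 hΛ2 hsup hv 1 (by simp)
  have T2 := part_tendsto hu hφ.continuous hφ0 hΛ2 hsup hv (-1) (by simp)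
  simp only [one_mul, neg_one_mul] at T1 T2
  have T3 := GT_tendsto hd hs0 hs1 hφL hr
  set I2 := ∫ x, φ x ^ 2 with hI2
  have hφ2 : Integrable (fun x => φ x ^ 2) :=
    cs_int (hφ.continuous.pow 2) (fun x hx => by rw [hsup x hx]; simp)
  have T4 : Tendsto (fun h : ℝ => (Λ * h)^α) (𝓝[>] 0) (𝓝 0) := by
    have : Continuous (fun h : ℝ => (Λ * h)^α) :=
      (continuous_const.mul continuous_id).rpow_const (fun _ => Or.inr hα.le)
    have h2 := (this.tendsto 0).mono_left (nhdsWithin_le_nhds (s := Ioi 0))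
    simpa [Real.zero_rpow hα.ne'] using h2
  have A : Tendsto (fun h : ℝ => 8 * ((4*ρ)^((d:ℝ)+2*s))⁻¹ *
      ((∫ x, φ x * max ((u (x + h • v) - u x) / h) 0) *
       (∫ x, φ x * max (-((u (x + h • v) - u x) / h)) 0))) (𝓝[>] 0) (𝓝 _) :=
    (T1.mul T2).const_mul _
  have B : Tendsto (fun h : ℝ => Cm d s * L^2 * JJ d s u x₀ (4*ρ)
      + 18 * Λ^2 * (∫ p, GT d s φ (4*h) p) + 2 / c * (Cα * (Λ * h)^α * Λ^2 * I2)) (𝓝[>] 0)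
      (𝓝 (Cm d s * L^2 * JJ d s u x₀ (4*ρ))) := by
    have := (tendsto_const_nhds (x := Cm d s * L^2 * JJ d s u x₀ (4*ρ))).add
      (T3.const_mul (18 * Λ^2)) |>.add
      ((((T4.const_mul Cα).mul_const (Λ^2)).mul_const I2).const_mul (2/c))
    simpa using this
  refine le_of_tendsto_of_tendsto A B ?_
  have hsm : ∀ᶠ h : ℝ in 𝓝[>] 0, h < ρ := nhdsWithin_le_nhds (Iio_mem_nhds hρ)
  filter_upwards [self_mem_nhdsWithin, hsm] with h hh hhρ
  have hh : 0 < h := hh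
  obtain ⟨hI, hmain⟩ := main_h hd hs0 hs1 hc huL hF hg heq hst hφL hr (h • v)
    (w := fun x => u (x + h • v) - u x) (fun _ => rfl)
  have huc := hu.continuous
  have hlow := pn_lower hs0 hφ.continuous hφ0 (w := fun x => u (x + h • v) - u x) (by fun_prop)
    hρ hsup hI
  have hrhs := rhs_bound hd hs0 hs1 huL hφL hφ hsup hL hLip hv hdv hΛ hh hhρ.le
  have hwb : ∀ x ∈ ball x₀ (2*ρ), |u (x + h • v) - u x| ≤ Λ * h := by
    intro x hx
    have h1 := hΛ2 x hx (x + h • v)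
    rw [abs_sub_comm] at h1
    simpa only [sub_add_cancel_left, norm_neg, norm_smul, hv, mul_one,
        Real.norm_of_nonneg hh.le] using h1
  have herr : ∫ x, ((F0 (x + h • v) - F0 x) * (u (x + h • v) - u x)
      - g x * (u (x + h • v) - u x) ^ 2) * φ x ^ 2 ≤
      ∫ x, Cα * (Λ * h)^α * (Λ * h)^2 * φ x ^ 2 := by
    refine int_le (hφ2.const_mul _) (fun x => by positivity) fun x => ?_
    by_cases hx : x ∈ ball x₀ (2*ρ)
    · refine mul_le_mul_of_nonneg_right ?_ (sq_nonneg _)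
      set w := u (x + h • v) - u x with hw
      have h1 := hHol x (x + h • v)
      rw [← hw] at h1
      have h2 := hwb x hx
      rw [← hw] at h2
      calc (F0 (x + h • v) - F0 x) * w - g x * w^2
          = (F0 (x + h • v) - F0 x - g x * w) * w := by ring
        _ ≤ |F0 (x + h • v) - F0 x - g x * w| * |w| := by
            rw [← abs_mul]; exact le_abs_self _
        _ ≤ (Cα * |w|^α * |w|) * |w| := by gcongr
        _ = Cα * |w|^α * |w|^2 := by ring
        _ ≤ Cα * (Λ * h)^α * (Λ * h)^2 := by gcongr
    · simp [hsup x hx]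
  rw [integral_const_mul] at herr
  have eP : ∫ x, φ x * max (u (x + h • v) - u x) 0
      = h * ∫ x, φ x * max ((u (x + h • v) - u x) / h) 0 := by
    rw [← integral_const_mul]
    congr 1; ext x
    have : max (u (x + h • v) - u x) 0 = h * max ((u (x + h • v) - u x) / h) 0 := by
      rw [mul_max_of_nonneg _ _ hh.le, mul_div_cancel₀ _ hh.ne', mul_zero]
    rw [this]; ring
  have eN : ∫ x, φ x * max (-(u (x + h • v) - u x)) 0
      = h * ∫ x, φ x * max (-((u (x + h • v) - u x) / h)) 0 := by
    rw [← integral_const_mul]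
    congr 1; ext x
    have : max (-(u (x + h • v) - u x)) 0 = h * max (-((u (x + h • v) - u x) / h)) 0 := by
      rw [mul_max_of_nonneg _ _ hh.le, mul_neg, mul_div_cancel₀ _ hh.ne', mul_zero]
    rw [this]; ring
  rw [eP, eN] at hlow
  have hc2 : 0 ≤ 2 / c := by positivity
  have herr2 := mul_le_mul_of_nonneg_left herr hc2
  have hh2 : 0 < h^2 := by positivity
  refine le_of_mul_le_mul_left ?_ hh2
  rw [← hI2] at herr2
  linarith

lemma ftc_bound {d : ℕ} {u : EE d → ℝ} (hu : ContDiff ℝ 1 u) (x z : EE d) :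
    |u x - u (x + z)| ≤ ∫ t in (0:ℝ)..1, ‖z‖ * ‖fderiv ℝ u (x + t • z)‖ := by
  have hdc : Continuous (fderiv ℝ u) := hu.continuous_fderiv (by simp)
  have hder : ∀ t : ℝ, HasDerivAt (fun t : ℝ => u (x + t • z)) (fderiv ℝ u (x + t • z) z) t := by
    intro t
    have h1 : HasFDerivAt u (fderiv ℝ u (x + t • z)) (x + t • z) :=
      ((hu.differentiable (by simp)) _).hasFDerivAt
    have h2 : HasDerivAt (fun t : ℝ => x + t • z) z t := by
      simpa using ((hasDerivAt_id t).smul_const z).const_add x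
    exact h1.comp_hasDerivAt t h2
  have hc1 : Continuous (fun t : ℝ => fderiv ℝ u (x + t • z) z) := by fun_prop
  have e := intervalIntegral.integral_eq_sub_of_hasDerivAt (a := 0) (b := 1)
    (fun t _ => hder t) (hc1.intervalIntegrable _ _)
  simp only [one_smul, zero_smul, add_zero] at e
  rw [abs_sub_comm, ← e, ← Real.norm_eq_abs]
  refine intervalIntegral.norm_integral_le_of_norm_le zero_le_one ?_ ?_
  · refine Eventually.of_forall fun t _ => ?_
    rw [mul_comm]
    exact ContinuousLinearMap.le_opNorm _ _
  · exact (by fun_prop : Continuous fun t : ℝ => ‖z‖ * ‖fderiv ℝ u (x + t • z)‖).intervalIntegrable _ _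

lemma shift_ball {d : ℕ} {g : EE d → ℝ} (hg : Continuous g) (hg0 : ∀ x, 0 ≤ g x) (x₀ : EE d)
    {r : ℝ} {z : EE d} (hz : ‖z‖ ≤ r) :
    ∫ x in ball x₀ r, g (x + z) ≤ ∫ x in ball x₀ (2*r), g x := by
  have h1 := (measurePreserving_add_right (volume : Measure (EE d)) z).setIntegral_preimage_emb
    (measurableEmbedding_addRight z) g (ball (x₀ + z) r)
  have h2 : (fun x => x + z) ⁻¹' ball (x₀ + z) r = ball x₀ r := by
    ext x; simp
  rw [h2] at h1
  rw [h1]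
  refine setIntegral_mono_set ?_ (Eventually.of_forall hg0) ?_
  · exact (hg.continuousOn.integrableOn_compact (isCompact_closedBall x₀ (2*r))).mono_set
      ball_subset_closedBall
  · refine LE.le.eventuallyLE (ball_subset_ball' ?_)
    simp [dist_eq_norm]; linarith

lemma diff_L1 {d : ℕ} {u : EE d → ℝ} (hu : ContDiff ℝ 1 u) (x₀ : EE d)
    {r : ℝ} {z : EE d} (hz : ‖z‖ ≤ r) :
    ∫ x in ball x₀ r, |u x - u (x + z)| ≤ ‖z‖ * ∫ x in ball x₀ (2*r), ‖fderiv ℝ u x‖ := by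
  have hdc : Continuous (fderiv ℝ u) := hu.continuous_fderiv (by simp)
  have huc := hu.continuous
  have hcc : Continuous (fun p : EE d × ℝ => ‖z‖ * ‖fderiv ℝ u (p.1 + p.2 • z)‖) := by fun_prop
  have hI : Integrable (fun p : EE d × ℝ => ‖z‖ * ‖fderiv ℝ u (p.1 + p.2 • z)‖)
      ((volume.restrict (ball x₀ r)).prod (volume.restrict (Ioc (0:ℝ) 1))) := by
    rw [Measure.prod_restrict]
    have := hcc.continuousOn.integrableOn_compact (μ := volume.prod volume)
      ((isCompact_closedBall x₀ r).prod (isCompact_Icc (a := (0:ℝ)) (b := 1)))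
    exact this.mono_set (prod_mono ball_subset_closedBall Ioc_subset_Icc_self)
  have hswap := integral_integral_swap (f := fun (x : EE d) (t : ℝ) =>
    ‖z‖ * ‖fderiv ℝ u (x + t • z)‖) hI
  have hleft : Integrable (fun x => ∫ t in Ioc (0:ℝ) 1, ‖z‖ * ‖fderiv ℝ u (x + t • z)‖)
    (volume.restrict (ball x₀ r)) := hI.integral_prod_left
  have hright : Integrable (fun t : ℝ => ∫ x in ball x₀ r, ‖z‖ * ‖fderiv ℝ u (x + t • z)‖)
    (volume.restrict (Ioc (0:ℝ) 1)) := hI.integral_prod_right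
  calc ∫ x in ball x₀ r, |u x - u (x + z)|
      ≤ ∫ x in ball x₀ r, ∫ t in Ioc (0:ℝ) 1, ‖z‖ * ‖fderiv ℝ u (x + t • z)‖ := by
        refine integral_mono ?_ hleft fun x => ?_
        · exact ((by fun_prop : Continuous fun x => |u x - u (x + z)|).continuousOn.integrableOn_compact
            (isCompact_closedBall x₀ r)).mono_set ball_subset_closedBall
        · have := ftc_bound hu x z
          rwa [intervalIntegral.integral_of_le zero_le_one] at this
    _ = ∫ t in Ioc (0:ℝ) 1, ∫ x in ball x₀ r, ‖z‖ * ‖fderiv ℝ u (x + t • z)‖ := hswap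
    _ ≤ ∫ t in Ioc (0:ℝ) 1, ‖z‖ * ∫ x in ball x₀ (2*r), ‖fderiv ℝ u x‖ := by
        refine setIntegral_mono_on hright (integrableOn_const (by simp)) measurableSet_Ioc
          fun t ht => ?_
        rw [integral_const_mul]
        refine mul_le_mul_of_nonneg_left ?_ (norm_nonneg _)
        refine shift_ball (g := fun x => ‖fderiv ℝ u x‖) hdc.norm (fun _ => norm_nonneg _) x₀ ?_
        rw [norm_smul, Real.norm_of_nonneg ht.1.le]
        exact (mul_le_of_le_one_left (norm_nonneg _) ht.2).trans hz
    _ = _ := by simp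

noncomputable def om (d : ℕ) : ℝ := volume.real (ball (0 : EE d) 1)

lemma om_nonneg (d : ℕ) : 0 ≤ om d := measureReal_nonneg

lemma ball_vol {d : ℕ} (hd : 1 ≤ d) (x : EE d) {r : ℝ} (hr : 0 ≤ r) :
    volume.real (ball x r) = r ^ d * om d := by
  have : Nonempty (Fin d) := ⟨⟨0, hd⟩⟩
  have h := Measure.addHaar_ball (volume : Measure (EE d)) x hr
  rw [om, measureReal_def, h, ENNReal.toReal_mul, ENNReal.toReal_ofReal (by positivity),
    measureReal_def]
  simp

noncomputable def Bk (d : ℕ) (s : ℝ) : ℝ := ∫ z : EE d, min ‖z‖ 1 * KK d s z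

lemma Bk_nonneg (d : ℕ) (s : ℝ) : 0 ≤ Bk d s :=
  integral_nonneg fun z => mul_nonneg (le_min (norm_nonneg _) zero_le_one) (KK_nonneg d s z)

lemma KK_int_r {d : ℕ} (hd : 1 ≤ d) {s : ℝ} (hs0 : 0 < s) (hs1 : s < 1/2) {r : ℝ} (hr : 0 < r) :
    Integrable (fun z : EE d => min (‖z‖ / r) 1 * KK d s z) := by
  refine ((KK_int d hd s hs0 hs1).const_mul (max (1/r) 1)).mono' ?_ (Eventually.of_forall fun z => ?_)
  · exact ((by fun_prop : Continuous fun z : EE d => min (‖z‖ / r) 1).measurable.mul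
      (KK_meas d s)).aestronglyMeasurable
  · have h0 : 0 ≤ min (‖z‖ / r) 1 := le_min (by positivity) zero_le_one
    rw [Real.norm_of_nonneg (mul_nonneg h0 (KK_nonneg d s z)), ← mul_assoc]
    refine mul_le_mul_of_nonneg_right ?_ (KK_nonneg d s z)
    have hm1 : (1:ℝ) ≤ max (1/r) 1 := le_max_right _ _
    have hm2 : 1/r ≤ max (1/r) 1 := le_max_left _ _
    rcases le_total ‖z‖ 1 with h | h
    · rw [min_eq_left h]
      refine (min_le_left _ _).trans ?_
      rw [div_eq_mul_one_div, mul_comm]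
      exact mul_le_mul_of_nonneg_right hm2 (norm_nonneg _)
    · rw [min_eq_right h]
      exact (min_le_right _ _).trans (by linarith)

lemma JJ_bound {d : ℕ} (hd : 1 ≤ d) {s : ℝ} (hs0 : 0 < s) (hs1 : s < 1/2)
    {u : EE d → ℝ} (hu : ContDiff ℝ 1 u) (hu1 : ∀ x, |u x| ≤ 1) (x₀ : EE d) {r : ℝ} (hr : 0 < r) :
    JJ d s u x₀ r ≤ r ^ (-2*s) * Bk d s *
      (2 * (r * ∫ x in ball x₀ (2*r), ‖fderiv ℝ u x‖) + 4 * (r ^ d * om d)) := by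
  have huL : LL u := LL.of_contDiff hu 1 zero_le_one hu1
  have huc := hu.continuous
  set S := ∫ x in ball x₀ (2*r), ‖fderiv ℝ u x‖ with hS
  have hS0 : 0 ≤ S := integral_nonneg fun x => norm_nonneg _
  set D := 2 * (r * S) + 4 * (r ^ d * om d) with hD
  have ho := om_nonneg d
  have hD0 : 0 ≤ D := by positivity
  let F : EE d × EE d → ℝ := fun p => (bi x₀ r p.1 * (u p.1 - u (p.1 + p.2))^2) * KK d s p.2
  have hFm : Measurable F := by
    have := bi_meas x₀ r
    have := KK_meas d s
    simp only [F]; fun_prop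
  have hFs : ∀ p : EE d × EE d, F (p.1, p.2 - p.1)
      = (bi x₀ r p.1 * (u p.1 - u p.2)^2) * KK d s (p.1 - p.2) := by
    intro p; simp only [F, add_sub_cancel, KK_comm d s p.2 p.1]
  have hJ := JJ_int hd hs0 hs1 huL x₀ r
  have hFi : Integrable F := by
    rw [← (shear_mp d).integrable_comp hFm.aestronglyMeasurable]
    exact hJ.congr (Eventually.of_forall fun p => (hFs p).symm)
  have hJF : JJ d s u x₀ r = ∫ p, F p := by
    rw [← (shear_mp d).map_eq, integral_map (shear_mp d).measurable.aemeasurable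
      hFm.aestronglyMeasurable]
    exact integral_congr_ae (Eventually.of_forall fun p => (hFs p).symm)
  rw [hJF, Measure.volume_eq_prod, integral_prod_symm _ (by rwa [← Measure.volume_eq_prod])]
  have hfin : r ^ (-2*s) * Bk d s * D = ∫ z : EE d, D * (min (‖z‖ / r) 1 * KK d s z) := by
    rw [integral_const_mul, KK_scale d s r hr, Bk]; ring
  rw [hfin]
  have hm0 : ∀ z : EE d, 0 ≤ min (‖z‖ / r) 1 := fun z => le_min (by positivity) zero_le_one
  refine int_le ((KK_int_r hd hs0 hs1 hr).const_mul D)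
    (fun z => mul_nonneg hD0 (mul_nonneg (hm0 z) (KK_nonneg d s z))) fun z => ?_
  simp only [F]
  rw [integral_mul_const, ← mul_assoc]
  refine mul_le_mul_of_nonneg_right ?_ (KK_nonneg d s z)
  have eI : ∫ x, bi x₀ r x * (u x - u (x + z))^2 = ∫ x in ball x₀ r, (u x - u (x + z))^2 := by
    rw [← integral_indicator measurableSet_ball]
    congr 1; ext x
    by_cases hx : x ∈ ball x₀ r
    · rw [bi_one hx, indicator_of_mem hx, one_mul]
    · rw [bi_zero hx, indicator_of_notMem hx, zero_mul]
  rw [eI]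
  have hci : ∀ {G : EE d → ℝ}, Continuous G → IntegrableOn G (ball x₀ r) := fun hG =>
    (hG.continuousOn.integrableOn_compact (isCompact_closedBall x₀ r)).mono_set
      ball_subset_closedBall
  have hd2 : ∀ x, |u x - u (x + z)| ≤ 2 := fun x =>
    (abs_sub _ _).trans (by linarith [hu1 x, hu1 (x + z)])
  rcases le_total r ‖z‖ with hz | hz
  · rw [min_eq_right (by rwa [one_le_div hr]), mul_one]
    have : ∫ x in ball x₀ r, (u x - u (x + z))^2 ≤ ∫ x in ball x₀ r, (4:ℝ) := by
      refine integral_mono (hci (by fun_prop)) (hci continuous_const) fun x => ?_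
      simp only
      rw [← sq_abs]
      nlinarith [hd2 x, abs_nonneg (u x - u (x + z))]
    rw [setIntegral_const, ball_vol hd x₀ hr.le, smul_eq_mul] at this
    have h3 : 0 ≤ r * S := by positivity
    linarith
  · rw [min_eq_left (by rwa [div_le_one hr])]
    have : ∫ x in ball x₀ r, (u x - u (x + z))^2 ≤ ∫ x in ball x₀ r, 2 * |u x - u (x + z)| := by
      refine integral_mono (hci (by fun_prop)) (hci (by fun_prop)) fun x => ?_
      simp only
      rw [← sq_abs]
      nlinarith [hd2 x, abs_nonneg (u x - u (x + z))]
    rw [integral_const_mul] at this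
    have h2 := diff_L1 hu x₀ hz
    have h3 : D * (‖z‖ / r) = 2 * (‖z‖ * S) + 4 * (r ^ d * om d) * (‖z‖ / r) := by
      rw [hD]; field_simp
    have h4 : 0 ≤ 4 * (r ^ d * om d) * (‖z‖ / r) := by positivity
    rw [h3]
    linarith

lemma cutoff (d : ℕ) : ∃ c0 : ℝ, 0 ≤ c0 ∧ ∀ (x₀ : EE d) (ρ : ℝ), 0 < ρ → ∃ φ : EE d → ℝ,
    ContDiff ℝ 1 φ ∧ (∀ x, 0 ≤ φ x) ∧ (∀ x, φ x ≤ 1) ∧ (∀ x, x ∉ ball x₀ (2*ρ) → φ x = 0) ∧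
    (∀ x ∈ ball x₀ ρ, φ x = 1) ∧ (∀ x y, |φ x - φ y| ≤ c0 / ρ * ‖x - y‖) := by
  let f : ContDiffBump (0 : EE d) := ⟨1, 2, one_pos, one_lt_two⟩
  have hf : ContDiff ℝ 1 f := f.contDiff
  obtain ⟨C, hC⟩ := hf.lipschitzWith_of_hasCompactSupport f.hasCompactSupport (by simp)
  refine ⟨C, C.2, fun x₀ ρ hρ => ⟨fun x => f (ρ⁻¹ • (x - x₀)), ?_, fun x => f.nonneg,
    fun x => f.le_one, fun x hx => ?_, fun x hx => ?_, fun x y => ?_⟩⟩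
  · exact hf.comp (by fun_prop)
  · apply f.zero_of_le_dist
    simp only [mem_ball, dist_eq_norm, not_lt] at hx
    simp only [dist_zero_right, norm_smul, norm_inv, Real.norm_of_nonneg hρ.le, f]
    rw [inv_mul_eq_div, le_div_iff₀ hρ]; exact hx
  · apply f.one_of_mem_closedBall
    simp only [mem_ball, dist_eq_norm] at hx
    simp only [mem_closedBall, dist_zero_right, norm_smul, norm_inv, Real.norm_of_nonneg hρ.le, f]
    rw [inv_mul_eq_div, div_le_iff₀ hρ]; linarith
  · have := hC.dist_le_mul (ρ⁻¹ • (x - x₀)) (ρ⁻¹ • (y - x₀))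
    rw [Real.dist_eq, dist_eq_norm, ← smul_sub, sub_sub_sub_cancel_right, norm_smul, norm_inv,
      Real.norm_of_nonneg hρ.le] at this
    refine this.trans (le_of_eq ?_)
    rw [div_eq_mul_inv]; ring

def PNP (d : ℕ) (s : ℝ) (u : EE d → ℝ) : Prop :=
  ∀ φ : EE d → ℝ, ContDiff ℝ 1 φ → (∀ x, 0 ≤ φ x) → (∀ x, φ x ≤ 1) →
    ∀ (x₀ : EE d) (ρ : ℝ), 0 < ρ → (∀ x, x ∉ ball x₀ (2*ρ) → φ x = 0) →
    ∀ L : ℝ, 0 ≤ L → (∀ x y, |φ x - φ y| ≤ L * ‖x - y‖) →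
    ∀ v : EE d, ‖v‖ = 1 → (∀ x, |fderiv ℝ φ x v| ≤ L) →
    8 * ((4*ρ)^((d:ℝ)+2*s))⁻¹ * ((∫ x, φ x * max (fderiv ℝ u x v) 0)
      * (∫ x, φ x * max (-fderiv ℝ u x v) 0)) ≤ Cm d s * L^2 * JJ d s u x₀ (4*ρ)

noncomputable def TT {d : ℕ} (u : EE d → ℝ) (x₀ : EE d) (r : ℝ) : ℝ :=
  r * ∫ x in ball x₀ r, ‖fderiv ℝ u x‖

lemma TT_nonneg {d : ℕ} (u : EE d → ℝ) (x₀ : EE d) {r : ℝ} (hr : 0 ≤ r) : 0 ≤ TT u x₀ r :=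
  mul_nonneg hr (integral_nonneg fun _ => norm_nonneg _)

lemma dir_est (d : ℕ) (hd : 1 ≤ d) (s : ℝ) (hs0 : 0 < s) (hs1 : s < 1/2) :
    ∃ A : ℝ, 0 ≤ A ∧ ∀ u : EE d → ℝ, ContDiff ℝ 1 u → (∀ x, |u x| ≤ 1) → PNP d s u →
    ∀ (x₀ : EE d) (ρ : ℝ), 0 < ρ → ∀ v : EE d, ‖v‖ = 1 →
    (ρ * ∫ x in ball x₀ ρ, |fderiv ℝ u x v|)^2 ≤ A * (ρ^d * (TT u x₀ (8*ρ) + ρ^d)) := by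
  obtain ⟨c0, hc0, hcut⟩ := cutoff d
  have hCm : 0 ≤ Cm d s := by unfold Cm; positivity
  have ho := om_nonneg d
  have hB := Bk_nonneg d s
  refine ⟨(c0 * 2^d * om d)^2 + 4 * (4^d * Cm d s * c0^2 * Bk d s * (1 + 4^(d+1) * om d)),
    by positivity, fun u hu hu1 hP x₀ ρ hρ v hv => ?_⟩
  obtain ⟨φ, hφ, hφ0, hφ1, hsup, hone, hLip⟩ := hcut x₀ ρ hρ
  have hL : 0 ≤ c0 / ρ := by positivity
  have hdn : ∀ x, ‖fderiv ℝ φ x‖ ≤ c0 / ρ := fun x =>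
    norm_fderiv_le_of_lip' ℝ hL (Eventually.of_forall fun y => hLip y x)
  have hdv : ∀ x, |fderiv ℝ φ x v| ≤ c0 / ρ := fun x => by
    have := (fderiv ℝ φ x).le_opNorm v
    rw [hv, mul_one] at this
    exact this.trans (hdn x)
  have hdz : ∀ x, x ∉ ball x₀ (2*ρ) → fderiv ℝ φ x v = 0 := by
    intro x hx
    have : IsLocalMin φ x := Eventually.of_forall fun y => by rw [hsup x hx]; exact hφ0 y
    rw [this.fderiv_eq_zero]; rfl
  have key := hP φ hφ hφ0 hφ1 x₀ ρ hρ hsup _ hL hLip v hv hdv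
  have hJ := JJ_bound hd hs0 hs1 hu hu1 x₀ (r := 4*ρ) (by positivity)
  have huc := hu.continuous
  have hφc := hφ.continuous
  have hduc : Continuous (fderiv ℝ u) := hu.continuous_fderiv (by simp)
  have hdφc : Continuous (fderiv ℝ φ) := hφ.continuous_fderiv (by simp)
  have iP : Integrable (fun x => φ x * max (fderiv ℝ u x v) 0) :=
    cs_int (by fun_prop) (fun x hx => by rw [hsup x hx, zero_mul])
  have iN : Integrable (fun x => φ x * max (-fderiv ℝ u x v) 0) :=
    cs_int (by fun_prop) (fun x hx => by rw [hsup x hx, zero_mul])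
  set P := ∫ x, φ x * max (fderiv ℝ u x v) 0 with hPd
  set N := ∫ x, φ x * max (-fderiv ℝ u x v) 0 with hNd
  have hP0 : 0 ≤ P := integral_nonneg fun x => mul_nonneg (hφ0 x) (le_max_right _ _)
  have hN0 : 0 ≤ N := integral_nonneg fun x => mul_nonneg (hφ0 x) (le_max_right _ _)
  have hPN : P - N = ∫ x, φ x * fderiv ℝ u x v := by
    rw [hPd, hNd, ← integral_sub iP iN]
    congr 1; ext x
    rw [← mul_sub]
    congr 1
    rcases le_total (fderiv ℝ u x v) 0 with h | h
    · rw [max_eq_right h, max_eq_left (by linarith)]; ring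
    · rw [max_eq_left h, max_eq_right (by linarith)]; ring
  have hPN2 : P - N = - ∫ x, fderiv ℝ φ x v * u x := by
    rw [hPN]
    refine integral_mul_fderiv_eq_neg_fderiv_mul_of_integrable ?_ ?_ ?_ ?_ ?_
    · exact cs_int (by fun_prop) (fun x hx => by rw [hdz x hx, zero_mul])
    · exact cs_int (by fun_prop) (fun x hx => by rw [hsup x hx, zero_mul])
    · exact cs_int (by fun_prop) (fun x hx => by rw [hsup x hx, zero_mul])
    · exact fun x _ => hφ.differentiable (by simp) x
    · exact fun x _ => hu.differentiable (by simp) x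
  have hPN3 : |P - N| ≤ c0 / ρ * ((2*ρ)^d * om d) := by
    rw [hPN2, abs_neg, ← Real.norm_eq_abs]
    have hb : Integrable (fun x => c0 / ρ * bi x₀ (2*ρ) x) := by
      refine Integrable.const_mul ?_ _
      exact (integrable_indicator_iff measurableSet_ball).2 (integrableOn_const measure_ball_lt_top.ne)
    refine (norm_integral_le_of_norm_le hb (Eventually.of_forall fun x => ?_)).trans ?_
    · by_cases hx : x ∈ ball x₀ (2*ρ)
      · rw [bi_one hx, norm_mul]
        exact mul_le_mul (hdv x) (hu1 x) (abs_nonneg _) hL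
      · rw [hdz x hx, bi_zero hx]; simp
    · rw [integral_const_mul]
      refine le_of_eq ?_
      congr 1
      rw [← ball_vol hd x₀ (by positivity)]
      simp only [bi]
      rw [integral_indicator measurableSet_ball, setIntegral_const]; simp
  have hlow : ∫ x in ball x₀ ρ, |fderiv ℝ u x v| ≤ P + N := by
    rw [hPd, hNd, ← integral_add iP iN, ← integral_indicator measurableSet_ball]
    refine int_le (iP.add iN) (fun x => add_nonneg (mul_nonneg (hφ0 x) (le_max_right _ _))
      (mul_nonneg (hφ0 x) (le_max_right _ _))) fun x => ?_
    have hab : max (fderiv ℝ u x v) 0 + max (-fderiv ℝ u x v) 0 = |fderiv ℝ u x v| := by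
      rcases le_total (fderiv ℝ u x v) 0 with h | h
      · rw [max_eq_right h, max_eq_left (by linarith), abs_of_nonpos h]; ring
      · rw [max_eq_left h, max_eq_right (by linarith), abs_of_nonneg h]; ring
    rw [← mul_add, hab]
    by_cases hx : x ∈ ball x₀ ρ
    · rw [indicator_of_mem hx, hone x hx, one_mul]
    · rw [indicator_of_notMem hx]; exact mul_nonneg (hφ0 x) (abs_nonneg _)
  have hI0 : 0 ≤ ∫ x in ball x₀ ρ, |fderiv ℝ u x v| := integral_nonneg fun _ => abs_nonneg _
  set T := TT u x₀ (8*ρ) with hT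
  have hT0 : 0 ≤ T := TT_nonneg u x₀ (by positivity)
  have eT : 2 * (4 * ρ * ∫ x in ball x₀ (2*(4*ρ)), ‖fderiv ℝ u x‖) = T := by
    rw [hT, TT, show 2 * (4*ρ) = 8 * ρ by ring]; ring
  rw [eT] at hJ
  set κ := (4*ρ)^((d:ℝ)+2*s) with hκ
  have hκ0 : 0 < κ := by positivity
  have eκ : κ * (4*ρ)^(-2*s) = 4^d * ρ^d := by
    rw [hκ, ← Real.rpow_add (by positivity), show (d:ℝ) + 2*s + -2*s = d by ring,
      Real.rpow_natCast, mul_pow]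
  set J := JJ d s u x₀ (4*ρ) with hJd
  have k2 : 8 * (ρ^2 * (P * N)) ≤ 4^d * Cm d s * c0^2 * Bk d s * (ρ^d * (T + 4^(d+1) * om d * ρ^d)) := by
    have h1 := mul_le_mul_of_nonneg_left key (by positivity : 0 ≤ κ * ρ^2)
    have e1 : κ * ρ^2 * (8 * κ⁻¹ * (P * N)) = 8 * (ρ^2 * (P * N)) := by field_simp
    have e2 : κ * ρ^2 * (Cm d s * (c0 / ρ)^2 * J) = Cm d s * c0^2 * κ * J := by field_simp
    rw [e1, e2] at h1
    have h2 := mul_le_mul_of_nonneg_left hJ (by positivity : 0 ≤ Cm d s * c0^2 * κ)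
    refine h1.trans (h2.trans (le_of_eq ?_))
    calc _ = Cm d s * c0^2 * (κ * (4*ρ)^(-2*s)) * Bk d s * (T + 4 * ((4*ρ)^d * om d)) := by ring
      _ = _ := by rw [eκ, mul_pow]; ring
  have k3 : (ρ * (P - N))^2 ≤ (c0 * 2^d * om d)^2 * (ρ^d * ρ^d) := by
    have : |ρ * (P - N)| ≤ c0 * 2^d * om d * ρ^d := by
      rw [abs_mul, abs_of_pos hρ]
      refine (mul_le_mul_of_nonneg_left hPN3 hρ.le).trans (le_of_eq ?_)
      rw [mul_pow]; field_simp
    rw [← sq_abs]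
    refine (pow_le_pow_left₀ (abs_nonneg _) this 2).trans (le_of_eq (by ring))
  have k4 : (ρ * ∫ x in ball x₀ ρ, |fderiv ℝ u x v|)^2 ≤ (ρ * (P + N))^2 :=
    pow_le_pow_left₀ (by positivity) (mul_le_mul_of_nonneg_left hlow hρ.le) 2
  have hr0 : 0 < ρ^d := by positivity
  have k5 : T + 4^(d+1) * om d * ρ^d ≤ (1 + 4^(d+1) * om d) * (T + ρ^d) := by
    have : 0 ≤ 4^(d+1) * om d * T := by positivity
    nlinarith
  have k6 : 4^d * Cm d s * c0^2 * Bk d s * (ρ^d * (T + 4^(d+1) * om d * ρ^d)) ≤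
      4^d * Cm d s * c0^2 * Bk d s * (ρ^d * ((1 + 4^(d+1) * om d) * (T + ρ^d))) := by gcongr
  have k7 : (c0 * 2^d * om d)^2 * (ρ^d * ρ^d) ≤ (c0 * 2^d * om d)^2 * (ρ^d * (T + ρ^d)) := by
    gcongr; linarith
  have k8 : 0 ≤ ρ^2 * (P * N) := by positivity
  have e9 : (ρ * (P + N))^2 = (ρ * (P - N))^2 + 4 * (ρ^2 * (P * N)) := by ring
  rw [add_mul]
  linarith

lemma op_le_sum {d : ℕ} (l : EE d →L[ℝ] ℝ) :
    ‖l‖ ≤ ∑ i, |l (EuclideanSpace.single i (1:ℝ))| := by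
  refine ContinuousLinearMap.opNorm_le_bound _ (Finset.sum_nonneg fun _ _ => abs_nonneg _) fun x => ?_
  have hx : x = ∑ i, x i • EuclideanSpace.single i (1:ℝ) := by
    have := (EuclideanSpace.basisFun (Fin d) ℝ).sum_repr x
    simpa using this.symm
  conv_lhs => rw [hx]
  rw [map_sum, Real.norm_eq_abs]
  refine (Finset.abs_sum_le_sum_abs _ _).trans ?_
  rw [Finset.sum_mul]
  refine Finset.sum_le_sum fun i _ => ?_
  rw [map_smul, smul_eq_mul, abs_mul, mul_comm]
  exact mul_le_mul_of_nonneg_left (PiLp.norm_apply_le x i) (abs_nonneg _)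

lemma grad_est (d : ℕ) (hd : 1 ≤ d) (s : ℝ) (hs0 : 0 < s) (hs1 : s < 1/2) (δ : ℝ) (hδ : 0 < δ) :
    ∃ M : ℝ, 0 ≤ M ∧ ∀ u : EE d → ℝ, ContDiff ℝ 1 u → (∀ x, |u x| ≤ 1) → PNP d s u →
    ∀ (x₀ : EE d) (ρ : ℝ), 0 < ρ → TT u x₀ ρ ≤ δ * TT u x₀ (8*ρ) + M * ρ^d := by
  obtain ⟨A, hA, H⟩ := dir_est d hd s hs0 hs1
  have hd0 : (0:ℝ) < d := by exact_mod_cast hd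
  set δ' := δ / d with hδ'
  have hδ0 : 0 < δ' := by positivity
  set M' := A / (2*δ') + A + 1 with hM'
  have hM0 : 0 ≤ M' := by positivity
  refine ⟨d * M', by positivity, fun u hu hu1 hP x₀ ρ hρ => ?_⟩
  have hduc : Continuous (fderiv ℝ u) := hu.continuous_fderiv (by simp)
  set T := TT u x₀ (8*ρ)
  have hT0 : 0 ≤ T := TT_nonneg u x₀ (by positivity)
  have hr0 : 0 < ρ^d := by positivity
  have each : ∀ i : Fin d, ρ * ∫ x in ball x₀ ρ, |fderiv ℝ u x (EuclideanSpace.single i (1:ℝ))|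
      ≤ δ' * T + M' * ρ^d := by
    intro i
    have h := H u hu hu1 hP x₀ ρ hρ (EuclideanSpace.single i (1:ℝ)) (by simp)
    refine le_of_sq_le_sq ?_ (by positivity)
    refine h.trans ?_
    have h1 : A ≤ 2 * δ' * M' := by
      have : 2 * δ' * (A / (2*δ')) = A := by field_simp
      have h2 : 0 ≤ 2 * δ' * (A + 1) := by positivity
      rw [hM']; nlinarith
    have h2 : A ≤ M'^2 := by
      have : 0 ≤ A / (2*δ') := by positivity
      have h3 : A ≤ M' := by rw [hM']; linarith
      have h4 : 1 ≤ M' := by rw [hM']; linarith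
      nlinarith
    have h3 := mul_le_mul_of_nonneg_right h1 (by positivity : 0 ≤ ρ^d * T)
    have h4 := mul_le_mul_of_nonneg_right h2 (by positivity : 0 ≤ ρ^d * ρ^d)
    have h5 : 0 ≤ (δ' * T)^2 := sq_nonneg _
    nlinarith
  have hint : ∀ {G : EE d → ℝ}, Continuous G → IntegrableOn G (ball x₀ ρ) := fun hG =>
    (hG.continuousOn.integrableOn_compact (isCompact_closedBall x₀ ρ)).mono_set
      ball_subset_closedBall
  have hsum : ∫ x in ball x₀ ρ, ‖fderiv ℝ u x‖ ≤
      ∑ i, ∫ x in ball x₀ ρ, |fderiv ℝ u x (EuclideanSpace.single i (1:ℝ))| := by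
    rw [← integral_finsetSum _ (fun i _ => hint (by fun_prop))]
    exact integral_mono (hint (by fun_prop)) (hint (by fun_prop)) fun x => op_le_sum _
  calc TT u x₀ ρ ≤ ρ * ∑ i, ∫ x in ball x₀ ρ, |fderiv ℝ u x (EuclideanSpace.single i (1:ℝ))| :=
        mul_le_mul_of_nonneg_left hsum hρ.le
    _ = ∑ i, ρ * ∫ x in ball x₀ ρ, |fderiv ℝ u x (EuclideanSpace.single i (1:ℝ))| :=
        Finset.mul_sum _ _ _
    _ ≤ ∑ _i : Fin d, (δ' * T + M' * ρ^d) := Finset.sum_le_sum fun i _ => each i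
    _ = δ * T + d * M' * ρ^d := by
        rw [Finset.sum_const, Finset.card_univ, Fintype.card_fin, nsmul_eq_mul, hδ']; field_simp

lemma TT_est (d : ℕ) (hd : 1 ≤ d) (s : ℝ) (hs0 : 0 < s) (hs1 : s < 1/2) :
    ∃ C : ℝ, 0 ≤ C ∧ ∀ u : EE d → ℝ, ContDiff ℝ 1 u → (∀ x, |u x| ≤ 1) → PNP d s u →
    ∀ (x₀ : EE d) (R : ℝ), 0 < R → TT u x₀ R ≤ C * R^d := by
  obtain ⟨t, hts, htf, hcov⟩ := finite_cover_balls_of_compact (isCompact_closedBall (0 : EE d) 1)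
    (by norm_num : (0:ℝ) < 1/32)
  lift t to Finset (EE d) using htf
  set N : ℝ := (t.card : ℝ) with hN
  have hN0 : 0 ≤ N := by positivity
  obtain ⟨M, hM0, hM⟩ := grad_est d hd s hs0 hs1 (1 / (64 * (N + 1))) (by positivity)
  refine ⟨64 * N * M, by positivity, fun u hu hu1 hP x₀ R hR => ?_⟩
  have hduc : Continuous (fderiv ℝ u) := hu.continuous_fderiv (by simp)
  have hint : ∀ (z : EE d) (r : ℝ), IntegrableOn (fun x => ‖fderiv ℝ u x‖) (ball z r) := fun z r =>
    (hduc.norm.continuousOn.integrableOn_compact (isCompact_closedBall z r)).mono_set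
      ball_subset_closedBall
  have hcover : ∀ (z : EE d) (r : ℝ), 0 < r → TT u z r ≤ 32 * ∑ y ∈ t, TT u (z + r • y) (r/32) := by
    intro z r hr
    have hsub : ball z r ⊆ ⋃ y ∈ t, ball (z + r • y) (r/32) := by
      intro x hx
      simp only [mem_ball, dist_eq_norm] at hx
      have h1 : r⁻¹ • (x - z) ∈ closedBall (0 : EE d) 1 := by
        simp only [mem_closedBall, dist_zero_right, norm_smul, norm_inv, Real.norm_of_nonneg hr.le]
        rw [inv_mul_eq_div, div_le_one hr]; exact hx.le
      have h2 := hcov h1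
      simp only [mem_iUnion, Finset.mem_coe, mem_ball, dist_eq_norm, exists_prop] at h2 ⊢
      obtain ⟨y, hy, hy2⟩ := h2
      refine ⟨y, hy, ?_⟩
      have e : x - (z + r • y) = r • (r⁻¹ • (x - z) - y) := by
        rw [smul_sub, smul_inv_smul₀ hr.ne']; abel
      rw [e, norm_smul, Real.norm_of_nonneg hr.le]
      have := mul_lt_mul_of_pos_left hy2 hr
      linarith
    have hind : ∫ x in ball z r, ‖fderiv ℝ u x‖ ≤
        ∑ y ∈ t, ∫ x in ball (z + r • y) (r/32), ‖fderiv ℝ u x‖ := by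
      have hI : ∀ y, Integrable ((ball (z + r • y) (r/32)).indicator fun x => ‖fderiv ℝ u x‖) :=
        fun y => (integrable_indicator_iff measurableSet_ball).2 (hint _ _)
      have hnn : ∀ y x, 0 ≤ (ball (z + r • y) (r/32)).indicator (fun x => ‖fderiv ℝ u x‖) x :=
        fun y x => indicator_nonneg (fun _ _ => norm_nonneg _) _
      rw [← integral_indicator measurableSet_ball]
      simp_rw [← integral_indicator measurableSet_ball]
      rw [← integral_finsetSum _ (fun y _ => hI y)]
      refine int_le (integrable_finsetSum _ fun y _ => hI y)
        (fun x => Finset.sum_nonneg fun y _ => hnn y x) fun x => ?_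
      by_cases hx : x ∈ ball z r
      · rw [indicator_of_mem hx]
        have := hsub hx
        simp only [mem_iUnion, exists_prop] at this
        obtain ⟨y, hy, hxy⟩ := this
        refine le_trans (le_of_eq ?_) (Finset.single_le_sum (fun y _ => hnn y x) hy)
        rw [indicator_of_mem hxy]
      · rw [indicator_of_notMem hx]
        exact Finset.sum_nonneg fun y _ => hnn y x
    unfold TT
    rw [← Finset.mul_sum]
    have := mul_le_mul_of_nonneg_left hind hr.le
    linarith
  obtain ⟨G, hG⟩ := (isCompact_closedBall x₀ (2*R)).exists_bound_of_continuousOn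
    hduc.continuousOn
  have hG0 : 0 ≤ G := (norm_nonneg _).trans (hG x₀ (mem_closedBall_self (by positivity)))
  have ho := om_nonneg d
  have hcrude : ∀ (z : EE d) (r : ℝ), 0 < r → ‖z - x₀‖ + 2 * r ≤ 2 * R →
      TT u z r / r^d ≤ R * (G * om d) := by
    intro z r hr hzr
    rw [div_le_iff₀ (by positivity)]
    have h1 : ∫ x in ball z r, ‖fderiv ℝ u x‖ ≤ ∫ x in ball z r, G := by
      refine setIntegral_mono_on (hint z r) (integrableOn_const measure_ball_lt_top.ne)
        measurableSet_ball fun x hx => hG x ?_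
      simp only [mem_ball, mem_closedBall, dist_eq_norm] at hx ⊢
      have := norm_add_le (x - z) (z - x₀)
      rw [sub_add_sub_cancel] at this
      linarith
    rw [setIntegral_const, ball_vol hd z hr.le, smul_eq_mul] at h1
    have hrR : r ≤ R := by linarith [norm_nonneg (z - x₀)]
    calc TT u z r ≤ r * (r^d * om d * G) := mul_le_mul_of_nonneg_left h1 hr.le
      _ ≤ R * (r^d * om d * G) := by gcongr
      _ = _ := by ring
  set V : Set ℝ := {a | ∃ (z : EE d) (r : ℝ), 0 < r ∧ ‖z - x₀‖ + 2 * r ≤ 2 * R ∧ a = TT u z r / r^d}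
    with hV
  have hbdd : BddAbove V := ⟨R * (G * om d), by
    rintro a ⟨z, r, hr, hzr, rfl⟩; exact hcrude z r hr hzr⟩
  have hmem : TT u x₀ R / R^d ∈ V := ⟨x₀, R, hR, by simp, rfl⟩
  set Q := sSup V with hQ
  have hQ0 : 0 ≤ Q := le_trans (div_nonneg (TT_nonneg u x₀ hR.le) (by positivity)) (le_csSup hbdd hmem)
  have hstep : Q ≤ Q / 2 + 32 * N * M := by
    refine csSup_le ⟨_, hmem⟩ ?_
    rintro a ⟨z, r, hr, hzr, rfl⟩
    rw [div_le_iff₀ (by positivity)]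
    refine (hcover z r hr).trans ?_
    have hrd : 0 < r^d := by positivity
    have each : ∀ y ∈ t, TT u (z + r • y) (r/32) ≤ (1 / (64 * (N + 1)) * Q + M) * r^d := by
      intro y hy
      have h1 := hM u hu hu1 hP (z + r • y) (r/32) (by positivity)
      rw [show 8 * (r/32) = r/4 by ring] at h1
      have hyn : ‖y‖ ≤ 1 := by simpa using hts hy
      have h2 : TT u (z + r • y) (r/4) / (r/4)^d ≤ Q := by
        refine le_csSup hbdd ⟨_, _, by positivity, ?_, rfl⟩
        have := norm_add_le (z - x₀) (r • y)
        rw [show z - x₀ + r • y = z + r • y - x₀ by abel, norm_smul, Real.norm_of_nonneg hr.le] at this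
        nlinarith
      rw [div_le_iff₀ (by positivity)] at h2
      have h3 : (r/4)^d ≤ r^d := pow_le_pow_left₀ (by positivity) (by linarith) d
      have h4 : (r/32)^d ≤ r^d := pow_le_pow_left₀ (by positivity) (by linarith) d
      have h5 : TT u (z + r • y) (r/4) ≤ Q * r^d := h2.trans (by gcongr)
      calc _ ≤ _ := h1
        _ ≤ 1 / (64 * (N + 1)) * (Q * r^d) + M * r^d := by gcongr
        _ = _ := by ring
    have h6 := Finset.sum_le_sum each
    rw [Finset.sum_const, nsmul_eq_mul, ← hN] at h6
    have h7 : N * (1 / (64 * (N + 1)) * Q) ≤ Q / 64 := by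
      rw [show N * (1 / (64 * (N + 1)) * Q) = N / (N + 1) * (Q / 64) by field_simp]
      refine mul_le_of_le_one_left (by positivity) ?_
      rw [div_le_one (by positivity)]; linarith
    have h8 := mul_le_mul_of_nonneg_right h7 hrd.le
    nlinarith
  have hQb : Q ≤ 64 * N * M := by linarith
  have := (le_csSup hbdd hmem).trans hQb
  rwa [div_le_iff₀ (by positivity)] at this

lemma Js_le {d : ℕ} (hd : 1 ≤ d) {s : ℝ} (hs0 : 0 < s) (hs1 : s < 1/2)
    {u : EE d → ℝ} (hu : LL u) (x₀ : EE d) (R : ℝ) :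
    Js d s u (ball x₀ R) ≤ ENNReal.ofReal (2 * JJ d s u x₀ R) := by
  have hJ := JJ_int hd hs0 hs1 hu x₀ R
  have hJ2 : Integrable (fun p : EE d × EE d =>
      (bi x₀ R p.2 * (u p.2 - u p.1)^2) * KK d s (p.2 - p.1)) :=
    (swap_mp d).integrable_comp_of_integrable hJ
  have eJ2 : ∫ p : EE d × EE d, (bi x₀ R p.2 * (u p.2 - u p.1)^2) * KK d s (p.2 - p.1)
      = JJ d s u x₀ R :=
    (swap_mp d).integral_comp (MeasurableEquiv.prodComm.measurableEmbedding)
      (fun p : EE d × EE d => (bi x₀ R p.1 * (u p.1 - u p.2)^2) * KK d s (p.1 - p.2))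
  have e : 2 * JJ d s u x₀ R = ∫ p : EE d × EE d,
      ((bi x₀ R p.1 * (u p.1 - u p.2)^2) * KK d s (p.1 - p.2)
        + (bi x₀ R p.2 * (u p.2 - u p.1)^2) * KK d s (p.2 - p.1)) := by
    rw [integral_add hJ hJ2, eJ2, ← JJ]; ring
  have n1 : ∀ p : EE d × EE d, 0 ≤ (bi x₀ R p.1 * (u p.1 - u p.2)^2) * KK d s (p.1 - p.2) :=
    fun p => mul_nonneg (mul_nonneg (bi_nonneg _ _ _) (sq_nonneg _)) (KK_nonneg d s _)
  have n2 : ∀ p : EE d × EE d, 0 ≤ (bi x₀ R p.2 * (u p.2 - u p.1)^2) * KK d s (p.2 - p.1) :=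
    fun p => mul_nonneg (mul_nonneg (bi_nonneg _ _ _) (sq_nonneg _)) (KK_nonneg d s _)
  have hJJ : Integrable (fun p : EE d × EE d =>
      (bi x₀ R p.1 * (u p.1 - u p.2)^2) * KK d s (p.1 - p.2)
        + (bi x₀ R p.2 * (u p.2 - u p.1)^2) * KK d s (p.2 - p.1)) := hJ.add hJ2
  rw [e, ofReal_integral_eq_lintegral_ofReal hJJ
    (Eventually.of_forall fun p => add_nonneg (n1 p) (n2 p))]
  unfold Js
  rw [← lintegral_indicator (measurableSet_ball.compl.prod measurableSet_ball.compl).compl]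
  refine lintegral_mono fun p => ?_
  by_cases hp : p ∈ ((ball x₀ R)ᶜ ×ˢ (ball x₀ R)ᶜ)ᶜ
  · rw [indicator_of_mem hp]
    refine ENNReal.ofReal_le_ofReal ?_
    have hk : (u p.1 - u p.2)^2 / ‖p.1 - p.2‖ ^ ((d : ℝ) + 2*s)
        = (u p.1 - u p.2)^2 * KK d s (p.1 - p.2) := by rw [KK, div_eq_mul_inv]
    rw [hk]
    by_cases h1 : p.1 ∈ ball x₀ R
    · have := n2 p
      rw [bi_one h1, one_mul]; linarith
    · have h2 : p.2 ∈ ball x₀ R := by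
        by_contra h2; exact hp ⟨h1, h2⟩
      have := n1 p
      rw [bi_one h2, one_mul, KK_comm d s p.2 p.1, ← neg_sub (u p.1), neg_sq]; linarith
  · rw [indicator_of_notMem hp]; exact zero_le

lemma fracC_pos (d : ℕ) (s : ℝ) (hs0 : 0 < s) (hs1 : s < 1/2) : 0 < fracC d s := by
  unfold fracC
  have h1 : 0 < Real.Gamma ((d : ℝ)/2 + s) := Real.Gamma_pos_of_pos (by positivity)
  have h2 : Real.Gamma (-s) ≠ 0 := by
    refine Real.Gamma_ne_zero fun m hm => ?_
    have hm' : s = m := by linarith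
    rcases Nat.eq_zero_or_pos m with h | h
    · subst h; simp at hm'; linarith
    · have : (1:ℝ) ≤ m := by exact_mod_cast h
      linarith
  have h3 : 0 < |Real.Gamma (-s)| := abs_pos.2 h2
  positivity

lemma hol_mvt {f f' : ℝ → ℝ} {α Cα : ℝ} (hα : 0 < α) (hC : 0 ≤ Cα)
    (hf : ∀ x ∈ Icc (-1 : ℝ) 1, HasDerivAt f (f' x) x)
    (hh : ∀ x ∈ Icc (-1 : ℝ) 1, ∀ y ∈ Icc (-1 : ℝ) 1, |f' x - f' y| ≤ Cα * |x - y| ^ α)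
    {a b : ℝ} (ha : a ∈ Icc (-1:ℝ) 1) (hb : b ∈ Icc (-1:ℝ) 1) :
    |f b - f a - f' a * (b - a)| ≤ Cα * |b - a|^α * |b - a| := by
  have hsub : uIcc a b ⊆ Icc (-1:ℝ) 1 := uIcc_subset_Icc ha hb
  have := (convex_uIcc a b).norm_image_sub_le_of_norm_hasDerivWithin_le
    (f := fun y => f y - f' a * y) (f' := fun y => f' y - f' a) (C := Cα * |b - a|^α)
    (x := a) (y := b) (fun y hy => by
      have h2 : HasDerivAt (fun y : ℝ => f' a * y) (f' a) y := by
        have h3 := (hasDerivAt_id' y).const_mul (f' a)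
        rwa [mul_one] at h3
      exact ((hf y (hsub hy)).sub h2).hasDerivWithinAt) (fun y hy => by
      refine (hh y (hsub hy) a ha).trans ?_
      have := abs_sub_left_of_mem_uIcc hy
      gcongr) left_mem_uIcc right_mem_uIcc
  simp only [Real.norm_eq_abs] at this
  rwa [show f b - f' a * b - (f a - f' a * a) = f b - f a - f' a * (b - a) by ring] at this

lemma hol_cont {f' : ℝ → ℝ} {α Cα : ℝ} (hα : 0 < α)
    (hh : ∀ x ∈ Icc (-1 : ℝ) 1, ∀ y ∈ Icc (-1 : ℝ) 1, |f' x - f' y| ≤ Cα * |x - y| ^ α) :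
    ContinuousOn f' (Icc (-1:ℝ) 1) := by
  intro x hx
  rw [ContinuousWithinAt, tendsto_iff_dist_tendsto_zero]
  have hc : Continuous fun y : ℝ => Cα * |y - x|^α :=
    continuous_const.mul ((continuous_id.sub continuous_const).abs.rpow_const fun _ => Or.inr hα.le)
  have h0 : Tendsto (fun y : ℝ => Cα * |y - x|^α) (𝓝[Icc (-1:ℝ) 1] x) (𝓝 0) := by
    have := (hc.tendsto x).mono_left (nhdsWithin_le_nhds (s := Icc (-1:ℝ) 1))
    simpa [Real.zero_rpow hα.ne'] using this
  refine squeeze_zero' (Eventually.of_forall fun _ => dist_nonneg) ?_ h0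
  filter_upwards [self_mem_nhdsWithin] with y hy
  rw [Real.dist_eq]; exact hh y hy x hx

lemma stable_PNP {d : ℕ} (hd : 1 ≤ d) {s : ℝ} (hs0 : 0 < s) (hs1 : s < 1/2) {α : ℝ}
    (hα : 1 - 2*s < α) {f f' : ℝ → ℝ} (hf : IsC1Alpha f f' α) {u : EE d → ℝ}
    (hu : IsStableSolution d s f f' u) : PNP d s u := by
  obtain ⟨hu2, hu1, heq, hst⟩ := hu
  obtain ⟨hfd, Cα, hC, hh⟩ := hf
  have hα0 : 0 < α := by linarith
  have hmem : ∀ x, u x ∈ Icc (-1:ℝ) 1 := fun x => abs_le.1 (hu1 x)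
  have hF : Continuous fun x => f (u x) := continuous_iff_continuousAt.2 fun x =>
    (hfd _ (hmem x)).continuousAt.comp hu2.continuous.continuousAt
  have hg : Continuous fun x => f' (u x) := (hol_cont hα0 hh).comp_continuous hu2.continuous hmem
  intro φ hφ hφ0 hφ1 x₀ ρ hρ hsup L hL hLip v hv hdv
  exact PN_bound hd hs0 hs1 (fracC_pos d s hs0 hs1) (hu2.of_le (by norm_num)) hu1 hF hg heq hst hα0 hC
    (fun x y => hol_mvt hα0 hC hfd hh (hmem x) (hmem y)) hφ hφ0 hφ1 hρ hsup hL hLip hv hdv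

lemma final_est (d : ℕ) (hd : 1 ≤ d) (s : ℝ) (hs0 : 0 < s) (hs1 : s < 1/2) :
    ∃ C₁ : ℝ, 0 < C₁ ∧ ∀ α : ℝ, 1 - 2*s < α → ∀ f f' : ℝ → ℝ, IsC1Alpha f f' α →
      ∀ u : EE d → ℝ, IsStableSolution d s f f' u →
      ∀ x₀ : EE d, ∀ R : ℝ, 1 ≤ R →
        Js d s u (ball x₀ R) ≤ ENNReal.ofReal (C₁ * R ^ ((d : ℝ) - 2*s)) := by
  obtain ⟨C, hC0, hC⟩ := TT_est d hd s hs0 hs1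
  have ho := om_nonneg d
  have hB := Bk_nonneg d s
  refine ⟨2 * (Bk d s * (C * 2^d + 4 * om d)) + 1, by positivity,
    fun α hα f f' hf u hu x₀ R hR => ?_⟩
  have hR0 : 0 < R := by linarith
  have hP := stable_PNP hd hs0 hs1 hα hf hu
  have hu2 : ContDiff ℝ 1 u := hu.1.of_le (by norm_num)
  have hu1 := hu.2.1
  refine (Js_le hd hs0 hs1 (LL.of_contDiff hu2 1 zero_le_one hu1) x₀ R).trans
    (ENNReal.ofReal_le_ofReal ?_)
  have hJ := JJ_bound hd hs0 hs1 hu2 hu1 x₀ hR0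
  have hT := hC u hu2 hu1 hP x₀ (2*R) (by positivity)
  have eT : 2 * (R * ∫ x in ball x₀ (2*R), ‖fderiv ℝ u x‖) = TT u x₀ (2*R) := by
    rw [TT]; ring
  rw [eT] at hJ
  have eR : R ^ ((d:ℝ) - 2*s) = R^(-2*s) * R^d := by
    rw [← Real.rpow_natCast, ← Real.rpow_add hR0]; congr 1; ring
  have hRp : 0 < R^(-2*s) := by positivity
  have h1 : R^(-2*s) * Bk d s * (TT u x₀ (2*R) + 4 * (R^d * om d)) ≤
      R^(-2*s) * Bk d s * (C * (2*R)^d + 4 * (R^d * om d)) := by gcongr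
  have e2 : R^(-2*s) * Bk d s * (C * (2*R)^d + 4 * (R^d * om d)) =
      Bk d s * (C * 2^d + 4 * om d) * (R^(-2*s) * R^d) := by rw [mul_pow]; ring
  have h3 : 0 < R^(-2*s) * R^d := by positivity
  rw [eR, add_mul]
  linarith

/-- Let `d ≥ 1`, `0 < s < 1/2`, `f` be `C^{1,α}` with `α > 1−2s`, and let
`u` be a stable solution of `(−Δ)^s u = f(u)` in `ℝ^d` with `|u| ≤ 1`. Then there is
`C₁ = C₁(d,s)`, independent of `f`, such that for every `x₀` and `R ≥ 1`:
`J^s(u,B_R(x₀)) ≤ C₁ · R^{d−2s}`. -/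
theorem stmt12 (d : ℕ) (hd : 1 ≤ d) (s : ℝ) (hs0 : 0 < s) (hs1 : s < 1/2) :
    ∃ C₁ : ℝ, 0 < C₁ ∧ ∀ α : ℝ, 1 - 2*s < α → ∀ f f' : ℝ → ℝ, IsC1Alpha f f' α →
      ∀ u : EuclideanSpace ℝ (Fin d) → ℝ, IsStableSolution d s f f' u →
      ∀ x₀ : EuclideanSpace ℝ (Fin d), ∀ R : ℝ, 1 ≤ R →
        Js d s u (ball x₀ R) ≤ ENNReal.ofReal (C₁ * R ^ ((d : ℝ) - 2*s)) := by
  exact final_est d hd s hs0 hs1
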